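/- arXiv:1112.4751 — 6 statements merged into one kernel-verified Lean document; each statement's English description precedes it below -/
import Mathlib

section
/- Assume the Weyl hypothesis N₁(K)/K → 𝓛/π as K → ∞. Then the two-particle counting function N₂(λ) := card {(n,m) ∈ ℕ × ℕ : k_n² + k_m² ≤ λ} is finite for every λ ∈ ℝ and satisfies N₂(λ)/λ → 𝓛²/(4π) as λ → ∞. -/
open Filter Topology

lemma tpw_bound (N : ℝ → ℝ) (hmono : Monotone N) (hN : ∀ x, 0 ≤ N x) (c : ℝ) (hc : 0 ≤ c)
    (h : Tendsto (fun K : ℝ => N K / K) atTop (𝓝 c)) (ε : ℝ) (hε : 0 < ε) :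
    ∃ C : ℝ, 0 ≤ C ∧ ∀ x, 0 ≤ x → |N x - c * x| ≤ ε * x + C := by
  have h1 := (Metric.tendsto_atTop.1 h) ε hε
  obtain ⟨X, hX⟩ := h1
  set Y := max X 1 with hY
  have hY1 : 1 ≤ Y := le_max_right _ _
  have hYX : X ≤ Y := le_max_left _ _
  refine ⟨N Y + c * Y, by have := hN Y; positivity, ?_⟩
  intro x hx
  have hNY := hN Y
  have hNx := hN x
  have hcx : 0 ≤ c * x := by positivity
  have hcY : 0 ≤ c * Y := by positivity
  have hex : 0 ≤ ε * x := by positivity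
  rcases le_total x Y with hxY | hxY
  · have := hmono hxY
    have : c * x ≤ c * Y := by gcongr
    rw [abs_le]; constructor <;> linarith
  · have hx0 : 0 < x := by linarith
    have := hX x (by linarith)
    rw [Real.dist_eq] at this
    have e : N x - c * x = (N x / x - c) * x := by field_simp
    rw [e, abs_mul, abs_of_pos hx0]
    have : |N x / x - c| * x ≤ ε * x := by gcongr
    linarith

lemma tpw_quarter (R : ℝ) (hR : 0 < R) :
    ∫ y in (0:ℝ)..R, √(R ^ 2 - y ^ 2) = Real.pi / 4 * R ^ 2 := by
  have h0 : ∫ x in (0:ℝ)..1, √(1 - x ^ 2) = Real.pi / 4 := by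
    have hi : ∀ a b : ℝ, IntervalIntegrable (fun x : ℝ => √(1 - x ^ 2)) MeasureTheory.volume a b :=
      fun a b => (by fun_prop : Continuous (fun x : ℝ => √(1 - x ^ 2))).intervalIntegrable a b
    have h := integral_sqrt_one_sub_sq
    rw [← intervalIntegral.integral_add_adjacent_intervals (hi (-1) 0) (hi 0 1)] at h
    have h2 : ∫ x in (-1:ℝ)..0, √(1 - x ^ 2) = ∫ x in (0:ℝ)..1, √(1 - x ^ 2) := by
      have := intervalIntegral.integral_comp_neg (a := (0:ℝ)) (b := 1) (fun x : ℝ => √(1 - x ^ 2))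
      simp only [neg_zero, neg_sq] at this
      exact this.symm
    linarith
  have h1 := intervalIntegral.integral_comp_mul_left (a := (0:ℝ)) (b := 1)
    (fun y : ℝ => √(R ^ 2 - y ^ 2)) hR.ne'
  have h2 : ∀ x : ℝ, √(R ^ 2 - (R * x) ^ 2) = R * √(1 - x ^ 2) := by
    intro x
    rw [show R ^ 2 - (R * x) ^ 2 = R ^ 2 * (1 - x ^ 2) by ring, Real.sqrt_mul (by positivity),
      Real.sqrt_sq hR.le]
  simp only [h2, intervalIntegral.integral_const_mul, h0, mul_zero, mul_one, smul_eq_mul] at h1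
  field_simp at h1
  linarith

lemma tpw_ind_eq (R a : ℝ) (ha : 0 ≤ a) (haR : a ≤ R) :
    IntervalIntegrable (fun y : ℝ => if a ≤ √(R ^ 2 - y ^ 2) then (1:ℝ) else 0)
      MeasureTheory.volume 0 R ∧
    ∫ y in (0:ℝ)..R, (if a ≤ √(R ^ 2 - y ^ 2) then (1:ℝ) else 0) = √(R ^ 2 - a ^ 2) := by
  have hR : 0 ≤ R := ha.trans haR
  constructor
  · apply AntitoneOn.intervalIntegrable
    intro x hx y hy hxy
    rw [Set.uIcc_of_le hR] at hx hy
    have : √(R ^ 2 - y ^ 2) ≤ √(R ^ 2 - x ^ 2) := by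
      apply Real.sqrt_le_sqrt
      have := pow_le_pow_left₀ hx.1 hxy 2
      linarith
    dsimp only
    split_ifs <;> first | (exfalso; linarith) | norm_num
  · have hs : √(R ^ 2 - a ^ 2) ≤ R := by
      rw [Real.sqrt_le_left hR]; nlinarith
    have := intervalIntegral.integral_indicator (μ := MeasureTheory.volume)
      (f := fun _ : ℝ => (1:ℝ)) (a₁ := 0) (a₂ := √(R ^ 2 - a ^ 2)) (a₃ := R)
      ⟨Real.sqrt_nonneg _, hs⟩
    rw [intervalIntegral.integral_const, smul_eq_mul, mul_one, sub_zero] at this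
    rw [← this]
    apply intervalIntegral.integral_congr
    intro y hy
    rw [Set.uIcc_of_le hR] at hy
    simp only [Set.indicator, Set.mem_ofPred_eq]
    have h1 : a ≤ √(R ^ 2 - y ^ 2) ↔ y ≤ √(R ^ 2 - a ^ 2) := by
      rw [Real.le_sqrt ha (by nlinarith [hy.1, hy.2]), Real.le_sqrt hy.1 (by nlinarith)]
      constructor <;> intro h <;> linarith
    simp only [h1]

lemma tpw_main (k : ℕ → ℝ) (hk : ∀ n, 0 ≤ k n) (N : ℝ → ℝ) (c ε C : ℝ) (hc : 0 ≤ c)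
    (hC : 0 ≤ C) (hε : 0 < ε)
    (hb : ∀ x, 0 ≤ x → |N x - c * x| ≤ ε * x + C) (R : ℝ) (hR : 0 < R) (S : Finset ℕ)
    (hS : ∀ n, n ∈ S ↔ k n ≤ R) (hNR : N R = S.card)
    (hN : ∀ x, x ≤ R → N x = ∑ n ∈ S, if k n ≤ x then (1:ℝ) else 0) :
    |∑ n ∈ S, N √(R ^ 2 - k n ^ 2) - c ^ 2 * Real.pi / 4 * R ^ 2|
      ≤ ((2 * c + ε) * R + C) * (ε * R + C) := by
  have hsR : ∀ y : ℝ, √(R ^ 2 - y ^ 2) ≤ R := fun y => by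
    rw [Real.sqrt_le_left hR.le]; nlinarith [sq_nonneg y]
  have hb' : ∀ y : ℝ, |N √(R ^ 2 - y ^ 2) - c * √(R ^ 2 - y ^ 2)| ≤ ε * R + C := fun y => by
    refine (hb _ (Real.sqrt_nonneg _)).trans ?_
    have := hsR y
    gcongr
  have h1 : |∑ n ∈ S, N √(R ^ 2 - k n ^ 2) - c * ∑ n ∈ S, √(R ^ 2 - k n ^ 2)|
      ≤ N R * (ε * R + C) := by
    rw [Finset.mul_sum, ← Finset.sum_sub_distrib, hNR]
    refine (Finset.abs_sum_le_sum_abs _ _).trans ?_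
    refine (Finset.sum_le_sum fun n _ => hb' (k n)).trans ?_
    rw [Finset.sum_const, nsmul_eq_mul]
  have hind := fun n (hn : n ∈ S) => tpw_ind_eq R (k n) (hk n) ((hS n).1 hn)
  have hfun : (fun y : ℝ => N √(R ^ 2 - y ^ 2)) =
      fun y => ∑ n ∈ S, if k n ≤ √(R ^ 2 - y ^ 2) then (1:ℝ) else 0 := by
    funext y; exact hN _ (hsR y)
  have hint : IntervalIntegrable (fun y : ℝ => N √(R ^ 2 - y ^ 2)) MeasureTheory.volume 0 R := by
    rw [hfun]
    have := IntervalIntegrable.sum S (fun n hn => (hind n hn).1)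
    have e : (fun y => ∑ n ∈ S, if k n ≤ √(R ^ 2 - y ^ 2) then (1:ℝ) else 0) =
        ∑ n ∈ S, fun y => if k n ≤ √(R ^ 2 - y ^ 2) then (1:ℝ) else 0 := by
      funext y; simp only [Finset.sum_apply]
    rw [e]
    exact this
  have h2 : ∫ y in (0:ℝ)..R, N √(R ^ 2 - y ^ 2) = ∑ n ∈ S, √(R ^ 2 - k n ^ 2) := by
    rw [hfun, intervalIntegral.integral_finsetSum (fun n hn => (hind n hn).1)]
    exact Finset.sum_congr rfl fun n hn => (hind n hn).2
  have hint2 : IntervalIntegrable (fun y : ℝ => c * √(R ^ 2 - y ^ 2)) MeasureTheory.volume 0 R :=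
    (by fun_prop : Continuous (fun y : ℝ => c * √(R ^ 2 - y ^ 2))).intervalIntegrable _ _
  have h3 : |∑ n ∈ S, √(R ^ 2 - k n ^ 2) - c * (Real.pi / 4 * R ^ 2)| ≤ (ε * R + C) * R := by
    rw [← h2, ← tpw_quarter R hR, ← intervalIntegral.integral_const_mul,
      ← intervalIntegral.integral_sub hint hint2]
    have := intervalIntegral.norm_integral_le_of_norm_le_const (a := (0:ℝ)) (b := R)
      (f := fun y => N √(R ^ 2 - y ^ 2) - c * √(R ^ 2 - y ^ 2)) (C := ε * R + C)
      (fun y _ => hb' y)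
    rwa [sub_zero, abs_of_pos hR, Real.norm_eq_abs] at this
  have h4 : N R ≤ (c + ε) * R + C := by
    have := (abs_le.1 (hb R hR.le)).2
    linarith
  have hp : 0 ≤ ε * R + C := by positivity
  have h5 : N R * (ε * R + C) ≤ ((c + ε) * R + C) * (ε * R + C) := by gcongr
  have h6 : |c * ∑ n ∈ S, √(R ^ 2 - k n ^ 2) - c * (c * (Real.pi / 4 * R ^ 2))|
      ≤ c * ((ε * R + C) * R) := by
    rw [← mul_sub, abs_mul, abs_of_nonneg hc]
    gcongr
  rw [abs_le] at *
  constructor <;> nlinarith [h1.1, h1.2, h6.1, h6.2]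

theorem two_particle_weyl_law
    (k : ℕ → ℝ) (hk : ∀ n, 0 ≤ k n) (L : ℝ) (hL : 0 < L)
    (hfin : ∀ K : ℝ, {n : ℕ | k n ≤ K}.Finite)
    (hweyl : Tendsto (fun K : ℝ => (Nat.card {n : ℕ | k n ≤ K} : ℝ) / K)
      atTop (𝓝 (L / Real.pi))) :
    (∀ lam : ℝ, {p : ℕ × ℕ | k p.1 ^ 2 + k p.2 ^ 2 ≤ lam}.Finite) ∧
      Tendsto (fun lam : ℝ =>
          (Nat.card {p : ℕ × ℕ | k p.1 ^ 2 + k p.2 ^ 2 ≤ lam} : ℝ) / lam)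
        atTop (𝓝 (L ^ 2 / (4 * Real.pi))) := by
  have hle : ∀ (lam : ℝ) (n m : ℕ), k n ^ 2 + k m ^ 2 ≤ lam → k n ≤ √lam := fun lam n m h =>
    Real.le_sqrt_of_sq_le (by nlinarith [sq_nonneg (k m)])
  have hfin2 : ∀ lam : ℝ, {p : ℕ × ℕ | k p.1 ^ 2 + k p.2 ^ 2 ≤ lam}.Finite := by
    intro lam
    refine ((hfin √lam).prod (hfin √lam)).subset ?_
    rintro ⟨n, m⟩ h
    exact ⟨hle lam n m h, hle lam m n (by simpa [add_comm] using h)⟩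
  refine ⟨hfin2, ?_⟩
  set N : ℝ → ℝ := fun K => (Nat.card {n : ℕ | k n ≤ K} : ℝ) with hNdef
  have hNcard : ∀ K, N K = (hfin K).toFinset.card := by
    intro K
    simp only [hNdef]
    rw [← Set.ncard_eq_toFinset_card _ (hfin K)]
    rfl
  have hNmono : Monotone N := by
    intro x y hxy
    rw [hNcard, hNcard]
    norm_cast
    apply Finset.card_le_card
    intro n
    simp only [Set.Finite.mem_toFinset, Set.mem_ofPred_eq]
    intro h; linarith
  have hN0 : ∀ x, 0 ≤ N x := fun x => by simp [hNdef]
  have hπ := Real.pi_pos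
  set c := L / Real.pi with hcdef
  have hc : 0 ≤ c := by positivity
  have hlim : L ^ 2 / (4 * Real.pi) = c ^ 2 * Real.pi / 4 := by
    rw [hcdef]; field_simp
  rw [hlim, Metric.tendsto_atTop]
  intro δ hδ
  set ε := min 1 (δ / (8 * (c + 1))) with hεdef
  have hε : 0 < ε := by positivity
  have hε1 : ε ≤ 1 := min_le_left _ _
  have hε2 : ε * (8 * (c + 1)) ≤ δ := by
    rw [← le_div_iff₀ (by positivity)]; exact min_le_right _ _
  obtain ⟨C, hC, hb⟩ := tpw_bound N hNmono hN0 c hc hweyl ε hε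
  refine ⟨max 1 ((C / ε) ^ 2), fun lam hlam => ?_⟩
  have hlam1 : 1 ≤ lam := (le_max_left _ _).trans hlam
  have hlam2 : (C / ε) ^ 2 ≤ lam := (le_max_right _ _).trans hlam
  set R := √lam with hRdef
  have hR : 0 < R := Real.sqrt_pos.2 (by linarith)
  have hR2 : lam = R ^ 2 := (Real.sq_sqrt (by linarith)).symm
  have hCR : C ≤ ε * R := by
    have : C / ε ≤ R := Real.le_sqrt_of_sq_le hlam2
    rw [div_le_iff₀ hε] at this
    linarith
  set S := (hfin R).toFinset with hSdef
  have hS : ∀ n, n ∈ S ↔ k n ≤ R := by intro n; simp [hSdef]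
  have hN : ∀ x, x ≤ R → N x = ∑ n ∈ S, if k n ≤ x then (1:ℝ) else 0 := by
    intro x hx
    rw [hNcard, Finset.sum_boole]
    congr 2
    ext n
    simp only [Set.Finite.mem_toFinset, Set.mem_ofPred_eq, Finset.mem_filter, hS]
    exact ⟨fun h => ⟨h.trans hx, h⟩, fun h => h.2⟩
  have hN2 : (Nat.card {p : ℕ × ℕ | k p.1 ^ 2 + k p.2 ^ 2 ≤ lam} : ℝ)
      = ∑ n ∈ S, N √(R ^ 2 - k n ^ 2) := by
    have e1 : Nat.card {p : ℕ × ℕ | k p.1 ^ 2 + k p.2 ^ 2 ≤ lam}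
        = ((S ×ˢ S).filter (fun p : ℕ × ℕ => k p.1 ^ 2 + k p.2 ^ 2 ≤ lam)).card := by
      rw [← Set.ncard_coe_finset]
      change Set.ncard _ = _
      congr 1
      ext ⟨n, m⟩
      simp only [Set.mem_ofPred_eq, Finset.coe_filter, Finset.mem_product, hS]
      exact ⟨fun h => ⟨⟨hle lam n m h, hle lam m n (by linarith)⟩, h⟩, fun h => h.2⟩
    rw [e1, ← Finset.sum_boole, Finset.sum_product]
    refine Finset.sum_congr rfl fun n hn => ?_
    have hnR := (hS n).1 hn
    rw [hN _ (by rw [Real.sqrt_le_left hR.le]; nlinarith [sq_nonneg (k n)])]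
    refine Finset.sum_congr rfl fun m _ => ?_
    have : k n ^ 2 + k m ^ 2 ≤ lam ↔ k m ≤ √(R ^ 2 - k n ^ 2) := by
      rw [Real.le_sqrt (hk m) (by nlinarith [hk n]), hR2]
      constructor <;> intro h <;> linarith
    simp only [this]
  have key := tpw_main k hk N c ε C hc hC hε hb R hR S hS (hNcard R) hN
  rw [hN2, Real.dist_eq, hR2]
  have e : (∑ n ∈ S, N √(R ^ 2 - k n ^ 2)) / R ^ 2 - c ^ 2 * Real.pi / 4
      = (∑ n ∈ S, N √(R ^ 2 - k n ^ 2) - c ^ 2 * Real.pi / 4 * R ^ 2) / R ^ 2 := by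
    field_simp
  rw [e, abs_div, abs_of_pos (by positivity : 0 < R ^ 2), div_lt_iff₀ (by positivity)]
  have hb1 : ((2 * c + ε) * R + C) * (ε * R + C)
      ≤ ((2 * c + ε) * R + ε * R) * (ε * R + ε * R) := by gcongr
  have hb2 : ((2 * c + ε) * R + ε * R) * (ε * R + ε * R) = (4 * ε * (c + ε)) * R ^ 2 := by ring
  have hb3 : 4 * ε * (c + ε) < δ := by
    have : 4 * ε * (c + ε) ≤ 4 * ε * (c + 1) := by gcongr
    have : 0 < ε * (c + 1) := by positivity
    linarith
  have hb4 : (4 * ε * (c + ε)) * R ^ 2 < δ * R ^ 2 := by gcongr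
  linarith
end

section
/- Assume the Weyl hypothesis N₁(K)/K → 𝓛/π as K → ∞. Then the bosonic two-particle counting function N_{2,B}(λ) := card {(n,m) ∈ ℕ × ℕ : n ≤ m and k_n² + k_m² ≤ λ} satisfies N_{2,B}(λ)/λ → 𝓛²/(8π) as λ → ∞. -/
open Filter Topology

/-- Uniform error bound at scale `R`. -/
lemma weyl_uniform (N : ℝ → ℝ) (hmono : Monotone N) (h0 : ∀ K, 0 ≤ N K) (c : ℝ)
    (h : Tendsto (fun K : ℝ => N K / K) atTop (𝓝 c)) (δ : ℝ) (hδ : 0 < δ) :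
    ∀ᶠ R : ℝ in atTop, ∀ K, 0 ≤ K → K ≤ R → |N K - c * K| ≤ δ * R := by
  have h1 : ∀ᶠ K : ℝ in atTop, |N K / K - c| < δ := by
    have := (Metric.tendsto_nhds.1 h) δ hδ
    simpa [Real.dist_eq] using this
  obtain ⟨K0, hK0⟩ := eventually_atTop.1 h1
  set K1 := max K0 1 with hK1
  have hK1pos : 0 < K1 := lt_of_lt_of_le one_pos (le_max_right _ _)
  filter_upwards [eventually_ge_atTop ((N K1 + |c| * K1) / δ)] with R hR K hK hKR
  rw [div_le_iff₀ hδ] at hR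
  rcases le_total K1 K with hle | hle
  · have hKpos : 0 < K := hK1pos.trans_le hle
    have h2 := (hK0 K ((le_max_left _ _).trans hle)).le
    have h3 : N K - c * K = (N K / K - c) * K := by field_simp
    rw [h3, abs_mul, abs_of_pos hKpos]
    exact mul_le_mul h2 hKR hK hδ.le
  · have h2 := hmono hle
    calc |N K - c * K| ≤ |N K| + |c * K| := abs_sub _ _
      _ = N K + |c| * K := by rw [abs_mul, abs_of_nonneg (h0 K), abs_of_nonneg hK]
      _ ≤ N K1 + |c| * K1 := by gcongr
      _ ≤ δ * R := by linarith

lemma quarter_disc (R : ℝ) (hR : 0 < R) :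
    ∫ y in (0:ℝ)..R, √(R ^ 2 - y ^ 2) = R ^ 2 * (Real.pi / 4) := by
  have hc : Continuous fun x : ℝ => √(1 - x ^ 2) := by fun_prop
  have h1 : ∫ x in (0:ℝ)..1, √(1 - x ^ 2) = Real.pi / 4 := by
    have ha := integral_sqrt_one_sub_sq
    rw [← intervalIntegral.integral_add_adjacent_intervals (b := 0)
      (hc.intervalIntegrable _ _) (hc.intervalIntegrable _ _)] at ha
    have hb := intervalIntegral.integral_comp_neg (a := 0) (b := 1) (fun x : ℝ => √(1 - x ^ 2))
    simp only [neg_sq, neg_zero] at hb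
    linarith
  have h2 := intervalIntegral.integral_comp_mul_left (a := 0) (b := 1)
    (fun y : ℝ => √(R ^ 2 - y ^ 2)) hR.ne'
  have h3 : ∀ x : ℝ, √(R ^ 2 - (R * x) ^ 2) = R * √(1 - x ^ 2) := by
    intro x
    rw [show R ^ 2 - (R * x) ^ 2 = R ^ 2 * (1 - x ^ 2) by ring,
      Real.sqrt_mul (sq_nonneg R), Real.sqrt_sq hR.le]
  simp only [h3, intervalIntegral.integral_const_mul, h1, mul_zero, mul_one, smul_eq_mul] at h2
  field_simp at h2 ⊢
  linarith

lemma integral_step (R a : ℝ) (ha : 0 ≤ a) (haR : a ≤ R) :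
    IntervalIntegrable (fun y : ℝ => if y ≤ a then (1:ℝ) else 0) MeasureTheory.volume 0 R ∧
    ∫ y in (0:ℝ)..R, (if y ≤ a then (1:ℝ) else 0) = a := by
  have hanti : Antitone (fun y : ℝ => if y ≤ a then (1:ℝ) else 0) := by
    intro x y hxy
    dsimp only
    split_ifs <;> first | linarith | norm_num
  refine ⟨hanti.intervalIntegrable, ?_⟩
  rw [← intervalIntegral.integral_add_adjacent_intervals (b := a)
    hanti.intervalIntegrable hanti.intervalIntegrable]
  have h1 : ∫ y in (0:ℝ)..a, (if y ≤ a then (1:ℝ) else 0) = ∫ y in (0:ℝ)..a, (1:ℝ) := by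
    apply intervalIntegral.integral_congr_ae
    filter_upwards with y hy
    rw [Set.uIoc_of_le ha] at hy
    simp [hy.2]
  have h2 : ∫ y in a..R, (if y ≤ a then (1:ℝ) else 0) = ∫ y in a..R, (0:ℝ) := by
    apply intervalIntegral.integral_congr_ae
    filter_upwards with y hy
    rw [Set.uIoc_of_le haR] at hy
    simp [hy.1]
  rw [h1, h2]
  simp

/-- The key estimate: error terms in the ordered-pair count. -/
lemma pair_estimate (k : ℕ → ℝ) (hk : ∀ n, 0 ≤ k n) (c : ℝ) (hc : 0 ≤ c) (R δ : ℝ) (hR : 0 < R)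
    (hδ : 0 ≤ δ) (S : Finset ℕ) (hS : ∀ n, n ∈ S ↔ k n ≤ R)
    (hu : ∀ K, 0 ≤ K → K ≤ R →
      |(∑ m ∈ S, if k m ≤ K then (1:ℝ) else 0) - c * K| ≤ δ * R) :
    |(∑ n ∈ S, ∑ m ∈ S, if k n ^ 2 + k m ^ 2 ≤ R ^ 2 then (1:ℝ) else 0)
      - c ^ 2 * (Real.pi / 4) * R ^ 2| ≤ δ * (2 * c + δ) * R ^ 2 := by
  have hsq : ∀ a y : ℝ, 0 ≤ a → 0 ≤ y → y ≤ R → (a ≤ √(R ^ 2 - y ^ 2) ↔ y ^ 2 + a ^ 2 ≤ R ^ 2) := by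
    intro a y ha hy hyR
    have h0 : 0 ≤ R ^ 2 - y ^ 2 := by nlinarith
    constructor
    · intro h
      have := Real.sq_sqrt h0
      nlinarith
    · intro h
      exact Real.le_sqrt_of_sq_le (by linarith)
  have hsR : ∀ y : ℝ, √(R ^ 2 - y ^ 2) ≤ R := by
    intro y
    apply Real.sqrt_le_iff.2 ⟨hR.le, by nlinarith [sq_nonneg y]⟩
  -- first step
  have e1 : |(∑ n ∈ S, ∑ m ∈ S, if k n ^ 2 + k m ^ 2 ≤ R ^ 2 then (1:ℝ) else 0)
      - c * ∑ n ∈ S, √(R ^ 2 - k n ^ 2)| ≤ S.card * (δ * R) := by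
    rw [Finset.mul_sum, ← Finset.sum_sub_distrib]
    refine (Finset.abs_sum_le_sum_abs _ _).trans ?_
    rw [← nsmul_eq_mul]
    apply Finset.sum_le_card_nsmul
    intro n hn
    have h := hu (√(R ^ 2 - k n ^ 2)) (Real.sqrt_nonneg _) (hsR _)
    simp only [hsq _ _ (hk _) (hk n) ((hS n).1 hn)] at h
    exact h
  have hcard : (S.card : ℝ) ≤ c * R + δ * R := by
    have h := hu R hR.le le_rfl
    rw [Finset.sum_congr rfl (g := fun _ => (1:ℝ))
      (fun m hm => by simp [(hS m).1 hm])] at h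
    simp only [Finset.sum_const, nsmul_eq_mul, mul_one] at h
    linarith [(abs_le.1 h).2]
  -- second step
  have hint : ∫ y in (0:ℝ)..R, (∑ m ∈ S, if y ≤ √(R ^ 2 - k m ^ 2) then (1:ℝ) else 0)
      = ∑ n ∈ S, √(R ^ 2 - k n ^ 2) := by
    rw [intervalIntegral.integral_finsetSum
      (fun m _ => (integral_step R _ (Real.sqrt_nonneg _) (hsR _)).1)]
    exact Finset.sum_congr rfl
      (fun m _ => (integral_step R _ (Real.sqrt_nonneg _) (hsR _)).2)
  have hii : IntervalIntegrable
      (fun y => (∑ m ∈ S, if y ≤ √(R ^ 2 - k m ^ 2) then (1:ℝ) else 0))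
      MeasureTheory.volume 0 R := by
    have := IntervalIntegrable.sum S (f := fun m y => if y ≤ √(R ^ 2 - k m ^ 2) then (1:ℝ) else 0)
      (fun m _ => (integral_step R _ (Real.sqrt_nonneg _) (hsR (k m))).1)
    simpa only [Finset.sum_fn] using this
  have hcont : Continuous fun y : ℝ => c * √(R ^ 2 - y ^ 2) := by fun_prop
  have e2 : |(∑ n ∈ S, √(R ^ 2 - k n ^ 2)) - c * (R ^ 2 * (Real.pi / 4))| ≤ δ * R * R := by
    rw [← hint, ← quarter_disc R hR, ← intervalIntegral.integral_const_mul,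
      ← intervalIntegral.integral_sub hii (hcont.intervalIntegrable _ _)]
    have := intervalIntegral.norm_integral_le_of_norm_le_const (a := 0) (b := R) (C := δ * R)
      (f := fun y => (∑ m ∈ S, if y ≤ √(R ^ 2 - k m ^ 2) then (1:ℝ) else 0)
        - c * √(R ^ 2 - y ^ 2)) ?_
    · simpa [abs_of_pos hR] using this
    · intro y hy
      rw [Set.uIoc_of_le hR.le] at hy
      have h := hu (√(R ^ 2 - y ^ 2)) (Real.sqrt_nonneg _) (hsR _)
      rw [Real.norm_eq_abs]
      convert h using 3
      refine Finset.sum_congr rfl fun m hm => ?_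
      simp only [hsq _ _ hy.1.le (hk m) ((hS m).1 hm), hsq _ _ (hk m) hy.1.le hy.2,
        add_comm (k m ^ 2)]
  have e2' : |c * (∑ n ∈ S, √(R ^ 2 - k n ^ 2)) - c ^ 2 * (Real.pi / 4) * R ^ 2|
      ≤ c * (δ * R * R) := by
    rw [show c * (∑ n ∈ S, √(R ^ 2 - k n ^ 2)) - c ^ 2 * (Real.pi / 4) * R ^ 2
      = c * ((∑ n ∈ S, √(R ^ 2 - k n ^ 2)) - c * (R ^ 2 * (Real.pi / 4))) by ring,
      abs_mul, abs_of_nonneg hc]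
    gcongr
  have e3 := abs_sub_le (∑ n ∈ S, ∑ m ∈ S, if k n ^ 2 + k m ^ 2 ≤ R ^ 2 then (1:ℝ) else 0)
    (c * ∑ n ∈ S, √(R ^ 2 - k n ^ 2)) (c ^ 2 * (Real.pi / 4) * R ^ 2)
  have e4 : (S.card : ℝ) * (δ * R) ≤ (c * R + δ * R) * (δ * R) := by gcongr
  nlinarith

/-- Unordered versus ordered pairs. -/
lemma boson_count (k : ℕ → ℝ) (hk : ∀ n, 0 ≤ k n) (R : ℝ) (hR : 0 < R)
    (S : Finset ℕ) (hS : ∀ n, n ∈ S ↔ k n ≤ R) :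
    (∑ n ∈ S, ∑ m ∈ S, if k n ^ 2 + k m ^ 2 ≤ R ^ 2 then (1:ℝ) else 0) ≤
      2 * (Nat.card {p : ℕ × ℕ | p.1 ≤ p.2 ∧ k p.1 ^ 2 + k p.2 ^ 2 ≤ R ^ 2} : ℝ) ∧
    2 * (Nat.card {p : ℕ × ℕ | p.1 ≤ p.2 ∧ k p.1 ^ 2 + k p.2 ^ 2 ≤ R ^ 2} : ℝ) ≤
    (∑ n ∈ S, ∑ m ∈ S, if k n ^ 2 + k m ^ 2 ≤ R ^ 2 then (1:ℝ) else 0) + S.card := by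
  classical
  set P := (S ×ˢ S).filter (fun p => k p.1 ^ 2 + k p.2 ^ 2 ≤ R ^ 2) with hP
  have hPm : ∀ p, p ∈ P ↔ k p.1 ^ 2 + k p.2 ^ 2 ≤ R ^ 2 := by
    intro p
    simp only [hP, Finset.mem_filter, Finset.mem_product, hS, and_iff_right_iff_imp]
    intro h
    constructor
    · exact abs_le_of_sq_le_sq' (by nlinarith [sq_nonneg (k p.2)]) hR.le |>.2
    · exact abs_le_of_sq_le_sq' (by nlinarith [sq_nonneg (k p.1)]) hR.le |>.2
  have hsum : (∑ n ∈ S, ∑ m ∈ S, if k n ^ 2 + k m ^ 2 ≤ R ^ 2 then (1:ℝ) else 0) = P.card := by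
    rw [hP, Finset.card_filter, Finset.sum_product]
    push_cast
    rfl
  set A := P.filter (fun p => p.1 ≤ p.2) with hA
  set B := P.filter (fun p => p.2 ≤ p.1) with hB
  have hcard : Nat.card {p : ℕ × ℕ | p.1 ≤ p.2 ∧ k p.1 ^ 2 + k p.2 ^ 2 ≤ R ^ 2} = A.card := by
    have : {p : ℕ × ℕ | p.1 ≤ p.2 ∧ k p.1 ^ 2 + k p.2 ^ 2 ≤ R ^ 2} = (A : Set (ℕ × ℕ)) := by
      ext p
      simp [hA, hPm, and_comm]
    rw [this]
    simp
  have hAB : A.card = B.card := by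
    refine Finset.card_bij' (fun p _ => p.swap) (fun p _ => p.swap) ?_ ?_ ?_ ?_
    · intro p hp
      simp only [hA, hB, Finset.mem_filter, hPm, Prod.fst_swap, Prod.snd_swap] at hp ⊢
      exact ⟨by linarith [hp.1], hp.2⟩
    · intro p hp
      simp only [hA, hB, Finset.mem_filter, hPm, Prod.fst_swap, Prod.snd_swap] at hp ⊢
      exact ⟨by linarith [hp.1], hp.2⟩
    · simp
    · simp
  have hun : A ∪ B = P := by
    ext p
    simp only [hA, hB, Finset.mem_union, Finset.mem_filter]
    have := le_total p.1 p.2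
    tauto
  have hin : (A ∩ B).card ≤ S.card := by
    apply Finset.card_le_card_of_injOn Prod.fst
    · intro p hp
      simp only [hA, hB, hP, Finset.coe_inter, Set.mem_inter_iff, Finset.mem_coe,
        Finset.mem_filter, Finset.mem_product] at hp ⊢
      exact hp.1.1.1.1
    · rintro ⟨a, b⟩ hp ⟨a', b'⟩ hq h
      simp only [hA, hB, Finset.coe_inter, Set.mem_inter_iff, Finset.mem_coe,
        Finset.mem_filter] at hp hq h
      ext <;> simp <;> omega
  have hcu := Finset.card_union_add_card_inter A B
  rw [hun] at hcu
  rw [hsum, hcard]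
  constructor
  · have : P.card ≤ 2 * A.card := by omega
    exact_mod_cast this
  · have : 2 * A.card ≤ P.card + S.card := by omega
    exact_mod_cast this

/-- Bosonic two-particle Weyl law: assuming the one-particle Weyl law
`N₁(K)/K → 𝓛/π`, the bosonic counting function
`N_{2,B}(λ) = #{(n,m) : n ≤ m, k_n² + k_m² ≤ λ}` satisfies
`N_{2,B}(λ)/λ → 𝓛²/(8π)`. -/
theorem bosonic_two_particle_weyl_law
    (k : ℕ → ℝ) (hk : ∀ n, 0 ≤ k n) (L : ℝ) (hL : 0 < L)
    (hfin : ∀ K : ℝ, {n : ℕ | k n ≤ K}.Finite)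
    (hweyl : Tendsto (fun K : ℝ => (Nat.card {n : ℕ | k n ≤ K} : ℝ) / K)
      atTop (𝓝 (L / Real.pi))) :
    Tendsto (fun lam : ℝ =>
        (Nat.card {p : ℕ × ℕ | p.1 ≤ p.2 ∧ k p.1 ^ 2 + k p.2 ^ 2 ≤ lam} : ℝ) / lam)
      atTop (𝓝 (L ^ 2 / (8 * Real.pi))) := by
  classical
  set c := L / Real.pi with hc
  have hcpos : 0 < c := div_pos hL Real.pi_pos
  have hlim : L ^ 2 / (8 * Real.pi) = c ^ 2 * (Real.pi / 4) / 2 := by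
    have := Real.pi_pos.ne'
    rw [hc]
    field_simp
    norm_num
  set N : ℝ → ℝ := fun K => (Nat.card {n : ℕ | k n ≤ K} : ℝ) with hN
  have hmono : Monotone N := by
    intro x y hxy
    simp only [hN]
    exact_mod_cast Nat.card_mono (hfin y) (fun n (hn : k n ≤ x) => hn.trans hxy)
  have hu := weyl_uniform N hmono (fun K => by simp [hN]) c hweyl
  have key : Tendsto (fun R : ℝ =>
      (Nat.card {p : ℕ × ℕ | p.1 ≤ p.2 ∧ k p.1 ^ 2 + k p.2 ^ 2 ≤ R ^ 2} : ℝ) / R ^ 2)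
      atTop (𝓝 (L ^ 2 / (8 * Real.pi))) := by
    rw [Metric.tendsto_nhds]
    intro η hη
    set δ := min 1 (η / (2 * c + 2)) with hδ
    have hδpos : 0 < δ := lt_min one_pos (by positivity)
    have hδ1 : δ ≤ 1 := min_le_left _ _
    have hδ2 : δ * (2 * c + 2) ≤ η := by
      rw [← le_div_iff₀ (by positivity)]
      exact min_le_right _ _
    filter_upwards [hu δ hδpos, eventually_gt_atTop 0, eventually_ge_atTop ((c + δ) / δ)]
      with R hR hR0 hR1
    have hS : ∀ n, n ∈ (hfin R).toFinset ↔ k n ≤ R := by simp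
    have hNs : ∀ K, K ≤ R →
        N K = ∑ m ∈ (hfin R).toFinset, if k m ≤ K then (1:ℝ) else 0 := by
      intro K hK
      have h1 : {n : ℕ | k n ≤ K} =
          ((hfin R).toFinset.filter (fun m => k m ≤ K) : Set ℕ) := by
        ext n
        simp only [Set.mem_ofPred_eq, Finset.coe_filter, hS]
        exact ⟨fun h => ⟨h.trans hK, h⟩, fun h => h.2⟩
      simp only [hN]
      rw [h1, Nat.card_coe_set_eq, Set.ncard_coe_finset, Finset.card_filter]
      push_cast
      rfl
    have hcardS : ((hfin R).toFinset.card : ℝ) = N R := by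
      rw [hNs R le_rfl, Finset.sum_congr rfl (g := fun _ => (1:ℝ))
        (fun m hm => by simp [(hS m).1 hm])]
      simp
    have e1 := pair_estimate k hk c hcpos.le R δ hR0 hδpos.le _ hS
      (fun K h0 h1 => by rw [← hNs K h1]; exact hR K h0 h1)
    obtain ⟨b1, b2⟩ := boson_count k hk R hR0 _ hS
    have hNR := (abs_le.1 (hR R hR0.le le_rfl)).2
    rw [hcardS] at b2
    rw [div_le_iff₀ hδpos] at hR1
    have hNR2 : N R ≤ δ * R ^ 2 := by nlinarith
    have hR2 : 0 < R ^ 2 := by positivity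
    obtain ⟨e1a, e1b⟩ := abs_le.1 e1
    have hq : δ * (2 * c + δ) * R ^ 2 + δ * R ^ 2 ≤ η * R ^ 2 := by
      rw [← add_mul]
      gcongr
      nlinarith
    have hηR : 0 < η * R ^ 2 := by positivity
    have hδR : 0 < δ * R ^ 2 := by positivity
    rw [Real.dist_eq, hlim, abs_lt]
    constructor
    · rw [lt_sub_iff_add_lt, lt_div_iff₀ hR2]
      linarith
    · rw [sub_lt_iff_lt_add, div_lt_iff₀ hR2]
      linarith
  have hcomp := key.comp Real.tendsto_sqrt_atTop
  refine hcomp.congr' ?_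
  filter_upwards [eventually_ge_atTop 0] with lam hlam
  simp only [Function.comp, Real.sq_sqrt hlam]
end

section
/- Assume the Weyl hypothesis N₁(K)/K → 𝓛/π as K → ∞. Then the fermionic two-particle counting function N_{2,F}(λ) := card {(n,m) ∈ ℕ × ℕ : n < m and k_n² + k_m² ≤ λ} satisfies N_{2,F}(λ)/λ → 𝓛²/(8π) as λ → ∞. -/
open Filter Topology

lemma fw_integral : ∫ x in (0:ℝ)..1, √(1 - x ^ 2) = Real.pi / 4 := by
  have h := integral_sqrt_one_sub_sq
  have hc : Continuous (fun x : ℝ => √(1 - x ^ 2)) := by fun_prop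
  have h1 : ∫ x in (-1:ℝ)..0, √(1 - x ^ 2) = ∫ x in (0:ℝ)..1, √(1 - x ^ 2) := by
    have := intervalIntegral.integral_comp_neg (a := (0:ℝ)) (b := 1) (fun x : ℝ => √(1 - x ^ 2))
    simp only [neg_sq, neg_zero] at this
    exact this.symm
  rw [← intervalIntegral.integral_add_adjacent_intervals (b := 0)
    (hc.intervalIntegrable _ _) (hc.intervalIntegrable _ _), h1] at h
  linarith

lemma fw_sums (M : ℕ) (hM : 0 < M) :
    (∑ j ∈ Finset.range M, 1 / (M:ℝ) * √(1 - ((j:ℝ) / M) ^ 2) ≤ Real.pi / 4 + 1 / M) ∧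
    (Real.pi / 4 - 1 / M ≤ ∑ j ∈ Finset.range M, 1 / (M:ℝ) * √(1 - (((j:ℝ) + 1) / M) ^ 2)) := by
  have hM' : (0:ℝ) < M := by exact_mod_cast hM
  have hanti : AntitoneOn (fun x : ℝ => √(1 - (x / M) ^ 2)) (Set.Icc (0:ℝ) (0 + (M:ℕ))) := by
    intro x hx y hy hxy
    have := hx.1
    apply Real.sqrt_le_sqrt
    gcongr
  have h1 := hanti.sum_le_integral
  have h2 := hanti.integral_le_sum
  have h3 : ∫ x in (0:ℝ)..(0 + (M:ℕ)), √(1 - (x / M) ^ 2) = M * (Real.pi / 4) := by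
    rw [intervalIntegral.integral_comp_div (fun x : ℝ => √(1 - x ^ 2)) hM'.ne']
    simp [hM'.ne', fw_integral]
  rw [h3] at h1 h2
  have h4 := Finset.sum_range_sub (fun j : ℕ => √(1 - ((j:ℝ) / M) ^ 2)) M
  rw [Finset.sum_sub_distrib] at h4
  simp only [zero_add, Nat.cast_add, Nat.cast_one, div_self hM'.ne', Nat.cast_zero, zero_div,
    one_pow, sub_self, Real.sqrt_zero, ne_eq, OfNat.ofNat_ne_zero, not_false_eq_true, zero_pow,
    sub_zero, Real.sqrt_one] at h1 h2 h4
  rw [← Finset.mul_sum, ← Finset.mul_sum]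
  constructor
  · rw [div_mul_eq_mul_div, one_mul, div_le_iff₀ hM', add_mul, div_mul_cancel₀ _ hM'.ne']
    linarith
  · rw [div_mul_eq_mul_div, one_mul, le_div_iff₀ hM', sub_mul, div_mul_cancel₀ _ hM'.ne']
    linarith

lemma fw_scale (N : ℝ → ℝ) (c : ℝ) (h : Tendsto (fun K => N K / K) atTop (𝓝 c))
    (a : ℝ) (ha : 0 ≤ a) : Tendsto (fun R => N (R * a) / R) atTop (𝓝 (c * a)) := by
  rcases ha.eq_or_lt with rfl | ha
  · simpa using tendsto_const_nhds.div_atTop (a := N 0) tendsto_id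
  · have h1 := (h.comp (tendsto_id.atTop_mul_const ha)).mul_const a
    refine h1.congr fun R => ?_
    simp only [Function.comp, id]
    field_simp

lemma fw_upper (k : ℕ → ℝ) (hk : ∀ n, 0 ≤ k n) (S : ℝ → Finset ℕ)
    (hS : ∀ K n, n ∈ S K ↔ k n ≤ K) (M : ℕ) (hM : 0 < M) (R : ℝ) (hR : 0 < R) :
    ((((S R ×ˢ S R).filter (fun p => k p.1 ^ 2 + k p.2 ^ 2 ≤ R ^ 2)).card : ℕ) : ℝ) ≤
      (S 0).card * (S R).card + ∑ j ∈ Finset.range M,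
        (((S (R * (((j:ℝ) + 1) / M))).card : ℝ) - (S (R * ((j:ℝ) / M))).card) *
          (S (R * √(1 - ((j:ℝ) / M) ^ 2))).card := by
  have hM' : (0:ℝ) < M := by exact_mod_cast hM
  have hsub : (S R ×ˢ S R).filter (fun p => k p.1 ^ 2 + k p.2 ^ 2 ≤ R ^ 2) ⊆
      (S 0 ×ˢ S R) ∪ (Finset.range M).biUnion (fun j =>
        (S (R * (((j:ℝ) + 1) / M)) \ S (R * ((j:ℝ) / M))) ×ˢ S (R * √(1 - ((j:ℝ) / M) ^ 2))) := by
    rintro ⟨n, m⟩ h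
    simp only [Finset.mem_filter, Finset.mem_product, hS] at h
    obtain ⟨⟨hn, hm⟩, hnm⟩ := h
    simp only [Finset.mem_union, Finset.mem_product, Finset.mem_biUnion, Finset.mem_sdiff,
      Finset.mem_range, hS]
    rcases (hk n).eq_or_lt with h0 | h0
    · left; exact ⟨h0.symm.le, hm⟩
    right
    have hx : 0 < k n * M / R := by positivity
    have hc : 0 < ⌈k n * M / R⌉₊ := Nat.ceil_pos.2 hx
    obtain ⟨j, hj⟩ : ∃ j, ⌈k n * M / R⌉₊ = j + 1 := ⟨_, (Nat.succ_pred_eq_of_pos hc).symm⟩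
    have hle : k n * M / R ≤ (j:ℝ) + 1 := by
      have := Nat.le_ceil (k n * M / R); rw [hj] at this; exact_mod_cast this
    have hlt : (j:ℝ) < k n * M / R := Nat.lt_ceil.1 (by omega)
    have hjM : j < M := by
      have : k n * M / R ≤ M := by
        rw [div_le_iff₀ hR]; nlinarith
      exact_mod_cast hlt.trans_le this
    rw [div_le_iff₀ hR] at hle
    rw [lt_div_iff₀ hR] at hlt
    have hlt' : R * ((j:ℝ) / M) < k n := by
      rw [← mul_div_assoc, div_lt_iff₀ hM']; linarith
    refine ⟨j, hjM, ⟨?_, not_le.2 hlt'⟩, ?_⟩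
    · rw [← mul_div_assoc, le_div_iff₀ hM']; linarith
    · have h5 : (R * ((j:ℝ) / M)) ^ 2 ≤ k n ^ 2 := by
        have : 0 ≤ R * ((j:ℝ) / M) := by positivity
        gcongr
      have h6 : k m / R ≤ √(1 - ((j:ℝ) / M) ^ 2) := by
        apply Real.le_sqrt_of_sq_le
        rw [div_pow, div_le_iff₀ (by positivity)]
        nlinarith
      rw [div_le_iff₀ hR] at h6
      linarith
  have h1 := (Finset.card_le_card hsub).trans ((Finset.card_union_le _ _).trans
    (add_le_add le_rfl Finset.card_biUnion_le))
  have h2 : ((((S R ×ˢ S R).filter (fun p => k p.1 ^ 2 + k p.2 ^ 2 ≤ R ^ 2)).card : ℕ) : ℝ) ≤ _ :=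
    Nat.cast_le.2 h1
  refine h2.trans (le_of_eq ?_)
  push_cast [Finset.card_product]
  congr 1
  refine Finset.sum_congr rfl fun j _ => ?_
  rw [Finset.cast_card_sdiff]
  intro n
  rw [hS, hS]
  intro h
  refine h.trans ?_
  gcongr
  linarith

lemma fw_lower (k : ℕ → ℝ) (hk : ∀ n, 0 ≤ k n) (S : ℝ → Finset ℕ)
    (hS : ∀ K n, n ∈ S K ↔ k n ≤ K) (M : ℕ) (hM : 0 < M) (R : ℝ) (hR : 0 < R) :
    ∑ j ∈ Finset.range M,
        (((S (R * (((j:ℝ) + 1) / M))).card : ℝ) - (S (R * ((j:ℝ) / M))).card) *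
          (S (R * √(1 - (((j:ℝ) + 1) / M) ^ 2))).card ≤
    ((((S R ×ˢ S R).filter (fun p => k p.1 ^ 2 + k p.2 ^ 2 ≤ R ^ 2)).card : ℕ) : ℝ) := by
  have hM' : (0:ℝ) < M := by exact_mod_cast hM
  have hsub : (Finset.range M).biUnion (fun j =>
        (S (R * (((j:ℝ) + 1) / M)) \ S (R * ((j:ℝ) / M))) ×ˢ
          S (R * √(1 - (((j:ℝ) + 1) / M) ^ 2))) ⊆
      (S R ×ˢ S R).filter (fun p => k p.1 ^ 2 + k p.2 ^ 2 ≤ R ^ 2) := by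
    rintro ⟨n, m⟩ h
    simp only [Finset.mem_product, Finset.mem_biUnion, Finset.mem_sdiff,
      Finset.mem_range, hS] at h
    obtain ⟨j, hj, ⟨h1, h2⟩, h3⟩ := h
    simp only [Finset.mem_filter, Finset.mem_product, hS]
    have hjM : ((j:ℝ) + 1) / M ≤ 1 := by
      rw [div_le_one hM']; exact_mod_cast hj
    have hj0 : 0 ≤ ((j:ℝ) + 1) / M := by positivity
    have hq : (((j:ℝ) + 1) / M) ^ 2 ≤ 1 := by nlinarith
    have a1 : k n ^ 2 ≤ (R * (((j:ℝ) + 1) / M)) ^ 2 := pow_le_pow_left₀ (hk n) h1 2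
    have a2 : k m ^ 2 ≤ (R * √(1 - (((j:ℝ) + 1) / M) ^ 2)) ^ 2 := pow_le_pow_left₀ (hk m) h3 2
    rw [mul_pow, Real.sq_sqrt (by linarith)] at a2
    have hs : k n ^ 2 + k m ^ 2 ≤ R ^ 2 := by nlinarith
    exact ⟨⟨abs_le_of_sq_le_sq' (by nlinarith [sq_nonneg (k m)]) hR.le |>.2,
      abs_le_of_sq_le_sq' (by nlinarith [sq_nonneg (k n)]) hR.le |>.2⟩, hs⟩
  have h1 := Finset.card_le_card hsub
  rw [Finset.card_biUnion] at h1
  · refine le_trans (le_of_eq ?_) (Nat.cast_le.2 h1)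
    push_cast [Finset.card_product]
    refine Finset.sum_congr rfl fun j _ => ?_
    rw [Finset.cast_card_sdiff]
    intro n
    rw [hS, hS]
    intro h
    refine h.trans ?_
    gcongr
    linarith
  · have key : ∀ i j : ℕ, i < j → ∀ n, k n ≤ R * (((i:ℝ) + 1) / M) → k n ≤ R * ((j:ℝ) / M) := by
      intro i j hij n h
      refine h.trans ?_
      gcongr
      exact_mod_cast hij
    intro i _ j _ hij
    simp only [Function.onFun]
    rw [Finset.disjoint_left]
    rintro ⟨n, m⟩ h h'
    simp only [Finset.mem_product, Finset.mem_sdiff, hS] at h h'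
    rcases lt_or_gt_of_ne hij with hl | hl
    · exact h'.1.2 (key i j hl n h.1.1)
    · exact h.1.2 (key j i hl n h'.1.1)

lemma fw_all (k : ℕ → ℝ) (hk : ∀ n, 0 ≤ k n) (S : ℝ → Finset ℕ)
    (hS : ∀ K n, n ∈ S K ↔ k n ≤ K) (c : ℝ) (h : Tendsto (fun K => ((S K).card : ℝ) / K) atTop (𝓝 c)) :
    Tendsto (fun R : ℝ => ((((S R ×ˢ S R).filter
      (fun p => k p.1 ^ 2 + k p.2 ^ 2 ≤ R ^ 2)).card : ℕ) : ℝ) / R ^ 2) atTop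
      (𝓝 (c ^ 2 * (Real.pi / 4))) := by
  have hsc := fw_scale (fun K => ((S K).card : ℝ)) c h
  have hsum : ∀ (M : ℕ) (g : ℕ → ℝ), (∀ j, 0 ≤ g j) → Tendsto (fun R : ℝ =>
      (∑ j ∈ Finset.range M,
        (((S (R * (((j:ℝ) + 1) / M))).card : ℝ) - (S (R * ((j:ℝ) / M))).card) *
          (S (R * g j)).card) / R ^ 2) atTop
      (𝓝 (c ^ 2 * ∑ j ∈ Finset.range M, 1 / (M:ℝ) * g j)) := by
    intro M g hg
    rw [Finset.mul_sum]
    simp_rw [Finset.sum_div]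
    refine tendsto_finsetSum _ fun j _ => ?_
    have := ((hsc (((j:ℝ) + 1) / M) (by positivity)).sub (hsc ((j:ℝ) / M) (by positivity))).mul
      (hsc (g j) (hg j))
    refine (this.congr fun R => ?_).trans (le_of_eq ?_)
    · rw [← sub_div, div_mul_div_comm, sq]
    · congr 1; ring
  have hz : Tendsto (fun R : ℝ => (((S 0).card : ℝ) * (S R).card) / R ^ 2) atTop (𝓝 0) := by
    have h1 : Tendsto (fun R : ℝ => ((S 0).card : ℝ) / R) atTop (𝓝 0) :=
      tendsto_const_nhds.div_atTop tendsto_id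
    have := h1.mul h
    rw [zero_mul] at this
    refine this.congr fun R => ?_
    rw [div_mul_div_comm, sq]
  have hM0 : Tendsto (fun M : ℕ => 1 / (M:ℝ)) atTop (𝓝 0) := tendsto_one_div_atTop_nhds_zero_nat
  rw [tendsto_order]
  constructor
  · intro a ha
    have ht : Tendsto (fun M : ℕ => c ^ 2 * (Real.pi / 4 - 1 / (M:ℝ))) atTop
        (𝓝 (c ^ 2 * (Real.pi / 4))) := by
      simpa using (hM0.const_sub (Real.pi / 4)).const_mul (c ^ 2)
    obtain ⟨M, hM1, hM⟩ := ((ht.eventually_const_lt ha).and (eventually_gt_atTop 0)).exists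
    have := hsum M (fun j => √(1 - (((j:ℝ) + 1) / M) ^ 2)) (fun _ => Real.sqrt_nonneg _)
    have hlt : a < c ^ 2 * ∑ j ∈ Finset.range M, 1 / (M:ℝ) * √(1 - (((j:ℝ) + 1) / M) ^ 2) :=
      hM1.trans_le (mul_le_mul_of_nonneg_left (fw_sums M hM).2 (sq_nonneg c))
    filter_upwards [this.eventually_const_lt hlt, eventually_gt_atTop 0] with R h1 hR
    refine h1.trans_le ?_
    have := fw_lower k hk S hS M hM R hR
    gcongr
  · intro a ha
    have ht : Tendsto (fun M : ℕ => c ^ 2 * (Real.pi / 4 + 1 / (M:ℝ))) atTop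
        (𝓝 (c ^ 2 * (Real.pi / 4))) := by
      simpa using (hM0.const_add (Real.pi / 4)).const_mul (c ^ 2)
    obtain ⟨M, hM1, hM⟩ := ((ht.eventually_lt_const ha).and (eventually_gt_atTop 0)).exists
    have := hz.add (hsum M (fun j => √(1 - ((j:ℝ) / M) ^ 2)) (fun _ => Real.sqrt_nonneg _))
    have hlt : 0 + c ^ 2 * ∑ j ∈ Finset.range M, 1 / (M:ℝ) * √(1 - ((j:ℝ) / M) ^ 2) < a := by
      rw [zero_add]
      exact (mul_le_mul_of_nonneg_left (fw_sums M hM).1 (sq_nonneg c)).trans_lt hM1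
    filter_upwards [this.eventually_lt_const hlt, eventually_gt_atTop 0] with R h1 hR
    refine lt_of_le_of_lt ?_ h1
    have := fw_upper k hk S hS M hM R hR
    rw [← add_div]
    gcongr

lemma fw_split (k : ℕ → ℝ) (hk : ∀ n, 0 ≤ k n) (S : ℝ → Finset ℕ)
    (hS : ∀ K n, n ∈ S K ↔ k n ≤ K) (R : ℝ) (hR : 0 < R) :
    (((S R ×ˢ S R).filter (fun p => k p.1 ^ 2 + k p.2 ^ 2 ≤ R ^ 2)).card : ℝ) =
    2 * (Nat.card {p : ℕ × ℕ | p.1 < p.2 ∧ k p.1 ^ 2 + k p.2 ^ 2 ≤ R ^ 2} : ℝ) +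
      (S (R * √(1 / 2))).card := by
  set P := (S R ×ˢ S R).filter (fun p => k p.1 ^ 2 + k p.2 ^ 2 ≤ R ^ 2) with hP
  have hmem : ∀ n m, (n, m) ∈ P ↔ k n ^ 2 + k m ^ 2 ≤ R ^ 2 := by
    intro n m
    simp only [hP, Finset.mem_filter, Finset.mem_product, hS, and_iff_right_iff_imp]
    intro hs
    exact ⟨abs_le_of_sq_le_sq' (by nlinarith [sq_nonneg (k m)]) hR.le |>.2,
      abs_le_of_sq_le_sq' (by nlinarith [sq_nonneg (k n)]) hR.le |>.2⟩
  clear_value P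
  have hF : Nat.card {p : ℕ × ℕ | p.1 < p.2 ∧ k p.1 ^ 2 + k p.2 ^ 2 ≤ R ^ 2} =
      (P.filter (fun p => p.1 < p.2)).card := by
    rw [Nat.card_coe_set_eq, ← Set.ncard_coe_finset]
    congr 1
    ext ⟨n, m⟩
    simp [hmem, and_comm]
  have hG : (P.filter (fun p => p.2 < p.1)).card = (P.filter (fun p => p.1 < p.2)).card := by
    apply Finset.card_bij (fun p _ => p.swap)
    · rintro ⟨n, m⟩ h
      simp only [Finset.mem_filter, hmem, Prod.swap_prod_mk] at h ⊢
      exact ⟨by linarith [h.1], h.2⟩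
    · rintro a _ b _ h
      exact Prod.swap_injective h
    · rintro ⟨n, m⟩ h
      simp only [Finset.mem_filter, hmem] at h
      refine ⟨(m, n), ?_, rfl⟩
      simp only [Finset.mem_filter, hmem]
      exact ⟨by linarith [h.1], h.2⟩
  have hD : (P.filter (fun p => p.1 = p.2)).card = (S (R * √(1 / 2))).card := by
    symm
    have hd : ∀ n, k n ≤ R * √(1 / 2) ↔ k n ^ 2 + k n ^ 2 ≤ R ^ 2 := by
      intro n
      rw [← sq_le_sq₀ (hk n) (by positivity), mul_pow, Real.sq_sqrt (by norm_num)]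
      constructor <;> intro h <;> linarith
    apply Finset.card_bij (fun n _ => (n, n))
    · intro n h
      simp only [Finset.mem_filter, hmem, hS, and_true] at h ⊢
      exact (hd n).1 h
    · intro a _ b _ h
      exact (Prod.ext_iff.1 h).1
    · rintro ⟨n, m⟩ h
      simp only [Finset.mem_filter, hmem] at h
      obtain ⟨h1, rfl⟩ := h
      exact ⟨n, (hS _ _).2 ((hd n).2 h1), rfl⟩
  have e1 := Finset.card_filter_add_card_filter_not (s := P) (fun p => p.1 < p.2)
  have e2 := Finset.card_filter_add_card_filter_not
    (s := P.filter (fun p => ¬ p.1 < p.2)) (fun p => p.1 = p.2)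
  rw [Finset.filter_filter, Finset.filter_filter] at e2
  have e3 : P.filter (fun p => ¬ p.1 < p.2 ∧ p.1 = p.2) = P.filter (fun p => p.1 = p.2) := by
    apply Finset.filter_congr; intros; omega
  have e4 : P.filter (fun p => ¬ p.1 < p.2 ∧ ¬ p.1 = p.2) = P.filter (fun p => p.2 < p.1) := by
    apply Finset.filter_congr; intros; omega
  rw [e3, e4] at e2
  rw [hF]
  norm_cast
  omega

/-- Fermionic two-particle Weyl law: assuming the one-particle Weyl law
`N₁(K)/K → 𝓛/π`, the fermionic counting function
`N_{2,F}(λ) = #{(n,m) : n < m, k_n² + k_m² ≤ λ}` satisfies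
`N_{2,F}(λ)/λ → 𝓛²/(8π)`. -/
theorem fermionic_two_particle_weyl_law
    (k : ℕ → ℝ) (hk : ∀ n, 0 ≤ k n) (L : ℝ) (hL : 0 < L)
    (hfin : ∀ K : ℝ, {n : ℕ | k n ≤ K}.Finite)
    (hweyl : Tendsto (fun K : ℝ => (Nat.card {n : ℕ | k n ≤ K} : ℝ) / K)
      atTop (𝓝 (L / Real.pi))) :
    Tendsto (fun lam : ℝ =>
        (Nat.card {p : ℕ × ℕ | p.1 < p.2 ∧ k p.1 ^ 2 + k p.2 ^ 2 ≤ lam} : ℝ) / lam)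
      atTop (𝓝 (L ^ 2 / (8 * Real.pi))) := by
  have hS : ∀ K n, n ∈ (hfin K).toFinset ↔ k n ≤ K := by intro K n; simp
  have h : Tendsto (fun K : ℝ => (((hfin K).toFinset.card : ℕ) : ℝ) / K)
      atTop (𝓝 (L / Real.pi)) := by
    refine hweyl.congr fun K => ?_
    rw [Nat.card_coe_set_eq, Set.ncard_eq_toFinset_card _ (hfin K)]
  have hA := fw_all k hk (fun K => (hfin K).toFinset) hS _ h
  have hD := (fw_scale (fun K : ℝ => (((hfin K).toFinset.card : ℕ) : ℝ)) _ h (√(1 / 2))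
    (Real.sqrt_nonneg _)).mul (tendsto_inv_atTop_zero (𝕜 := ℝ))
  have hF := ((hA.sub hD).div_const 2).comp Real.tendsto_sqrt_atTop
  have hlim : ((L / Real.pi) ^ 2 * (Real.pi / 4) - L / Real.pi * √(1 / 2) * 0) / 2 =
      L ^ 2 / (8 * Real.pi) := by
    have := Real.pi_ne_zero
    field_simp
    ring
  rw [hlim] at hF
  refine hF.congr' ?_
  filter_upwards [eventually_gt_atTop 0] with lam hlam
  have hs : 0 < √lam := Real.sqrt_pos.2 hlam
  have := fw_split k hk (fun K => (hfin K).toFinset) hS (√lam) hs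
  simp only [Function.comp]
  rw [this]
  have hsq : √lam ^ 2 = lam := Real.sq_sqrt hlam.le
  rw [hsq]
  have hinv : ∀ x : ℝ, x / √lam * (√lam)⁻¹ = x / lam := by
    intro x
    rw [div_mul_eq_mul_div, ← div_eq_mul_inv, div_div, ← sq, hsq]
  rw [hinv]
  ring
end

section
/- Suppose that for every t > 0 the series Σ_{n∈ℕ} exp(−μ_n t) converges, and that √t · Σ_{n∈ℕ} exp(−μ_n t) → C as t → 0⁺ for some constant C ≥ 0. Then N(x)/√x → 2C/√π as x → ∞. In particular, if C = 𝓛/√(4π) then N(k²)/k → 𝓛/π as k → ∞. -/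
open Filter Topology

namespace KaramataAux

open MeasureTheory Set

/-- exponential variable lies in the unit interval -/
lemma exp_mem {u : ℝ} (hu : 0 ≤ u) : Real.exp (-u) ∈ Icc (0:ℝ) 1 :=
  ⟨(Real.exp_pos _).le, by simpa using hu⟩

/-- the weighted sum functional -/
noncomputable def T (μ : ℕ → ℝ) (φ : ℝ → ℝ) (t : ℝ) : ℝ :=
  Real.sqrt t * ∑' n : ℕ, Real.exp (-(μ n * t)) * φ (Real.exp (-(μ n * t)))

/-- the limit functional -/
noncomputable def J (φ : ℝ → ℝ) : ℝ :=
  ∫ v in Ioi (0:ℝ), Real.exp (-(v ^ 2)) * φ (Real.exp (-(v ^ 2)))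

lemma gauss_int : IntegrableOn (fun v : ℝ => Real.exp (-(v ^ 2))) (Ioi 0) := by
  have := (integrable_exp_neg_mul_sq (b := 1) one_pos).integrableOn (s := Ioi (0:ℝ))
  simpa using this

lemma bdd_of_cont {φ : ℝ → ℝ} (hφ : Continuous φ) : ∃ M, ∀ y ∈ Icc (0:ℝ) 1, |φ y| ≤ M := by
  obtain ⟨M, hM⟩ := isCompact_Icc.exists_bound_of_continuousOn (s := Icc (0:ℝ) 1) hφ.continuousOn
  exact ⟨M, fun y hy => by simpa using hM y hy⟩

lemma J_int {φ : ℝ → ℝ} (hφ : Continuous φ) :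
    IntegrableOn (fun v : ℝ => Real.exp (-(v ^ 2)) * φ (Real.exp (-(v ^ 2)))) (Ioi 0) := by
  obtain ⟨M, hM⟩ := bdd_of_cont hφ
  refine Integrable.mono' (gauss_int.mul_const M) ?_ ?_
  · exact Continuous.aestronglyMeasurable (by fun_prop)
  · refine Eventually.of_forall fun v => ?_
    rw [norm_mul, Real.norm_eq_abs, Real.norm_eq_abs, abs_of_pos (Real.exp_pos _)]
    exact mul_le_mul_of_nonneg_left (hM _ (exp_mem (sq_nonneg v))) (Real.exp_pos _).le

lemma T_sum {μ : ℕ → ℝ} (hμ : ∀ n, 0 ≤ μ n) {t : ℝ} (ht : 0 < t)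
    (hsum : Summable fun n : ℕ => Real.exp (-(μ n * t))) {φ : ℝ → ℝ} (hφ : Continuous φ) :
    Summable fun n : ℕ => Real.exp (-(μ n * t)) * φ (Real.exp (-(μ n * t))) := by
  obtain ⟨M, hM⟩ := bdd_of_cont hφ
  refine Summable.of_norm_bounded (hsum.mul_right M) fun n => ?_
  rw [norm_mul, Real.norm_eq_abs, Real.norm_eq_abs, abs_of_pos (Real.exp_pos _)]
  exact mul_le_mul_of_nonneg_left (hM _ (exp_mem (mul_nonneg (hμ n) ht.le))) (Real.exp_pos _).le

lemma J_one : J (fun _ => 1) = Real.sqrt Real.pi / 2 := by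
  have := integral_gaussian_Ioi 1
  simpa [J] using this

lemma J_mono (k : ℕ) (a : ℝ) :
    J (fun y => a * y ^ k) = a * (Real.sqrt Real.pi / 2 / Real.sqrt (k + 1)) := by
  have h := integral_gaussian_Ioi ((k:ℝ) + 1)
  have : ∀ v : ℝ, Real.exp (-(v ^ 2)) * (a * (Real.exp (-(v ^ 2))) ^ k)
      = a * Real.exp (-((k:ℝ) + 1) * v ^ 2) := by
    intro v
    rw [← Real.exp_nat_mul, mul_left_comm, ← Real.exp_add]
    congr 2; ring
  simp only [J, this]
  rw [integral_const_mul, h, Real.sqrt_div Real.pi_pos.le]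
  ring

section
variable {μ : ℕ → ℝ} {C : ℝ}

lemma T_mono (htrace : Tendsto (fun t : ℝ => Real.sqrt t * ∑' n : ℕ, Real.exp (-(μ n * t)))
      (𝓝[>] 0) (𝓝 C)) (k : ℕ) (a : ℝ) :
    Tendsto (T μ (fun y => a * y ^ k)) (𝓝[>] 0)
      (𝓝 (2 * C / Real.sqrt Real.pi * J (fun y => a * y ^ k))) := by
  have hk : (0:ℝ) < k + 1 := by positivity
  have hs : Tendsto (fun t : ℝ => ((k:ℝ) + 1) * t) (𝓝[>] 0) (𝓝[>] 0) := by
    refine tendsto_nhdsWithin_iff.2 ⟨?_, ?_⟩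
    · have : Tendsto (fun t : ℝ => ((k:ℝ) + 1) * t) (𝓝 0) (𝓝 (((k:ℝ) + 1) * 0)) :=
        (continuous_const.mul continuous_id).tendsto 0
      rw [mul_zero] at this
      exact this.mono_left nhdsWithin_le_nhds
    · filter_upwards [self_mem_nhdsWithin] with t ht
      exact mul_pos hk ht
  have h := ((htrace.comp hs).const_mul (a / Real.sqrt (k + 1)))
  have hπ : Real.sqrt Real.pi ≠ 0 := (Real.sqrt_pos.2 Real.pi_pos).ne'
  have hk' : Real.sqrt ((k:ℝ) + 1) ≠ 0 := (Real.sqrt_pos.2 hk).ne'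
  rw [J_mono]
  convert h using 1
  · funext t
    have : ∀ n, Real.exp (-(μ n * t)) * (a * (Real.exp (-(μ n * t))) ^ k)
      = a * Real.exp (-(μ n * (((k:ℝ) + 1) * t))) := by
      intro v
      rw [← Real.exp_nat_mul, mul_left_comm, ← Real.exp_add]
      congr 2; ring
    simp only [T, this, Function.comp, tsum_mul_left, Real.sqrt_mul hk.le]
    generalize (∑' n : ℕ, Real.exp (-(μ n * (((k:ℝ) + 1) * t)))) = S
    field_simp
  · congr 1
    field_simp

lemma T_poly (hμ : ∀ n, 0 ≤ μ n)
    (hsum : ∀ t : ℝ, 0 < t → Summable fun n : ℕ => Real.exp (-(μ n * t)))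
    (htrace : Tendsto (fun t : ℝ => Real.sqrt t * ∑' n : ℕ, Real.exp (-(μ n * t)))
      (𝓝[>] 0) (𝓝 C)) (p : Polynomial ℝ) :
    Tendsto (T μ (fun y => p.eval y)) (𝓝[>] 0)
      (𝓝 (2 * C / Real.sqrt Real.pi * J (fun y => p.eval y))) := by
  induction p using Polynomial.induction_on' with
  | add p q hp hq =>
    have hJ : J (fun y => (p + q).eval y) = J (fun y => p.eval y) + J (fun y => q.eval y) := by
      simp only [J, Polynomial.eval_add, mul_add]
      exact integral_add (J_int p.continuous) (J_int q.continuous)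
    rw [hJ, mul_add]
    refine (hp.add hq).congr' ?_
    filter_upwards [self_mem_nhdsWithin] with t ht
    simp only [T, Polynomial.eval_add, mul_add]
    rw [(T_sum hμ ht (hsum t ht) p.continuous).tsum_add (T_sum hμ ht (hsum t ht) q.continuous),
      mul_add]
  | monomial k a =>
    simpa only [Polynomial.eval_monomial] using T_mono htrace k a

lemma J_close {φ ψ : ℝ → ℝ} (hφ : Continuous φ) (hψ : Continuous ψ) {ε : ℝ}
    (h : ∀ y ∈ Icc (0:ℝ) 1, |φ y - ψ y| ≤ ε) :
    |J φ - J ψ| ≤ ε * (Real.sqrt Real.pi / 2) := by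
  have h1 : J φ - J ψ = ∫ v in Ioi (0:ℝ), (Real.exp (-(v ^ 2)) * φ (Real.exp (-(v ^ 2)))
      - Real.exp (-(v ^ 2)) * ψ (Real.exp (-(v ^ 2)))) :=
    (integral_sub (J_int hφ) (J_int hψ)).symm
  have h2 : ∫ v in Ioi (0:ℝ), ε * Real.exp (-(v ^ 2)) = ε * (Real.sqrt Real.pi / 2) := by
    rw [integral_const_mul, ← J_one]; simp [J]
  rw [h1, ← h2, ← Real.norm_eq_abs]
  refine norm_integral_le_of_norm_le (gauss_int.const_mul ε) (Eventually.of_forall fun v => ?_)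
  rw [← mul_sub, norm_mul, Real.norm_eq_abs, Real.norm_eq_abs, abs_of_pos (Real.exp_pos _),
    mul_comm]
  exact mul_le_mul_of_nonneg_right (h _ (exp_mem (sq_nonneg v))) (Real.exp_pos _).le

lemma T_close (hμ : ∀ n, 0 ≤ μ n) {t : ℝ} (ht : 0 < t)
    (hsum : Summable fun n : ℕ => Real.exp (-(μ n * t)))
    {φ ψ : ℝ → ℝ} (hφ : Continuous φ) (hψ : Continuous ψ) {ε : ℝ}
    (h : ∀ y ∈ Icc (0:ℝ) 1, |φ y - ψ y| ≤ ε) :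
    |T μ φ t - T μ ψ t| ≤ ε * (Real.sqrt t * ∑' n : ℕ, Real.exp (-(μ n * t))) := by
  rw [T, T, ← mul_sub, ← (T_sum hμ ht hsum hφ).tsum_sub (T_sum hμ ht hsum hψ), abs_mul,
    abs_of_nonneg (Real.sqrt_nonneg t), mul_left_comm, ← tsum_mul_left]
  refine mul_le_mul_of_nonneg_left ?_ (Real.sqrt_nonneg t)
  rw [← Real.norm_eq_abs]
  refine tsum_of_norm_bounded (hsum.mul_left ε).hasSum fun n => ?_
  rw [← mul_sub, norm_mul, Real.norm_eq_abs, Real.norm_eq_abs, abs_of_pos (Real.exp_pos _),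
    mul_comm]
  exact mul_le_mul_of_nonneg_right (h _ (exp_mem (mul_nonneg (hμ n) ht.le))) (Real.exp_pos _).le

lemma T_cont (hμ : ∀ n, 0 ≤ μ n)
    (hsum : ∀ t : ℝ, 0 < t → Summable fun n : ℕ => Real.exp (-(μ n * t)))
    (htrace : Tendsto (fun t : ℝ => Real.sqrt t * ∑' n : ℕ, Real.exp (-(μ n * t)))
      (𝓝[>] 0) (𝓝 C)) (hC : 0 ≤ C) {φ : ℝ → ℝ} (hφ : Continuous φ) :
    Tendsto (T μ φ) (𝓝[>] 0) (𝓝 (2 * C / Real.sqrt Real.pi * J φ)) := by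
  rw [Metric.tendsto_nhds]
  intro ε hε
  set δ := ε / (2 * C + 3) with hδ
  have hδ0 : 0 < δ := by positivity
  obtain ⟨p, hp⟩ := exists_polynomial_near_of_continuousOn 0 1 φ hφ.continuousOn δ hδ0
  have h1 := Metric.tendsto_nhds.1 (T_poly hμ hsum htrace p) δ hδ0
  have h2 := htrace.eventually (gt_mem_nhds (show C < C + 1 by linarith))
  have hpφ : ∀ y ∈ Icc (0:ℝ) 1, |φ y - p.eval y| ≤ δ := fun y hy => by
    rw [abs_sub_comm]; exact (hp y hy).le
  have hJ := J_close hφ p.continuous hpφ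
  have hπ : 0 < Real.sqrt Real.pi := (Real.sqrt_pos.2 Real.pi_pos)
  have hJ' : |2 * C / Real.sqrt Real.pi * J φ
      - 2 * C / Real.sqrt Real.pi * J (fun y => p.eval y)| ≤ C * δ := by
    rw [← mul_sub, abs_mul, abs_of_nonneg (by positivity)]
    calc _ ≤ 2 * C / Real.sqrt Real.pi * (δ * (Real.sqrt Real.pi / 2)) := by gcongr
      _ = C * δ := by field_simp
  filter_upwards [h1, h2, self_mem_nhdsWithin] with t h1 h2 ht
  have h3 := T_close hμ ht (hsum t ht) hφ p.continuous hpφ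
  have h4 := h3.trans (mul_le_mul_of_nonneg_left h2.le hδ0.le)
  rw [Real.dist_eq] at h1 ⊢
  have h5 : δ * (2 * C + 3) = ε := by rw [hδ]; field_simp
  rw [abs_lt] at *
  rw [abs_le] at *
  constructor <;> nlinarith

/-- ramp function: zero below `a`, one above `b` -/
noncomputable def ramp (a b y : ℝ) : ℝ := max 0 (min 1 ((y - a) / (b - a)))

lemma ramp_cont (a b : ℝ) : Continuous (ramp a b) := by
  unfold ramp; fun_prop

lemma ramp_nonneg (a b y : ℝ) : 0 ≤ ramp a b y := le_max_left _ _
lemma ramp_le_one (a b y : ℝ) : ramp a b y ≤ 1 := max_le zero_le_one (min_le_left _ _)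
lemma ramp_zero {a b y : ℝ} (h : a < b) (hy : y ≤ a) : ramp a b y = 0 := by
  have : (y - a) / (b - a) ≤ 0 := div_nonpos_of_nonpos_of_nonneg (by linarith) (by linarith)
  exact max_eq_left ((min_le_right _ _).trans this)
lemma ramp_one {a b y : ℝ} (h : a < b) (hy : b ≤ y) : ramp a b y = 1 := by
  have : 1 ≤ (y - a) / (b - a) := by rw [le_div_iff₀ (by linarith)]; linarith
  rw [ramp, min_eq_left this, max_eq_right zero_le_one]

lemma ramp_mul {a b : ℝ} (ha : 0 < a) (h : a < b) (y : ℝ) :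
    y * (ramp a b y / max y a) = ramp a b y := by
  rcases le_total y a with hy | hy
  · simp [ramp_zero h hy]
  · rw [max_eq_left hy]; field_simp [(ha.trans_le hy).ne']

lemma ind_int (s : ℝ) (hs : 0 ≤ s) :
    IntegrableOn ((Ioc (0:ℝ) s).indicator (fun _ => (1:ℝ))) (Ioi 0) ∧
    ∫ v in Ioi (0:ℝ), (Ioc (0:ℝ) s).indicator (fun _ => (1:ℝ)) v = s := by
  constructor
  · refine Integrable.integrableOn ?_
    rw [integrable_indicator_iff measurableSet_Ioc]
    exact integrableOn_const (by simp)
  · rw [setIntegral_indicator measurableSet_Ioc, inter_eq_right.2 Ioc_subset_Ioi_self]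
    simp [hs]

/-- key sandwich -/
lemma sandwich (hμ : ∀ n, 0 ≤ μ n) (hfin : ∀ x : ℝ, {n : ℕ | μ n ≤ x}.Finite)
    (hsum : ∀ t : ℝ, 0 < t → Summable fun n : ℕ => Real.exp (-(μ n * t)))
    (htrace : Tendsto (fun t : ℝ => Real.sqrt t * ∑' n : ℕ, Real.exp (-(μ n * t)))
      (𝓝[>] 0) (𝓝 C)) (hC : 0 ≤ C) {r : ℝ} (hr : 1 < r) :
    ∃ (F : ℝ → ℝ) (G : ℝ), Tendsto F (𝓝[>] 0) (𝓝 (2 * C / Real.sqrt Real.pi * G)) ∧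
      1 ≤ G ∧ G ≤ r ∧ ∀ t, 0 < t →
        Real.sqrt t * (Nat.card {n : ℕ | μ n ≤ 1 / t} : ℝ) ≤ F t ∧
        F t ≤ Real.sqrt t * (Nat.card {n : ℕ | μ n ≤ r ^ 2 / t} : ℝ) := by
  set a := Real.exp (-(r ^ 2)) with ha
  set b := Real.exp (-1) with hb
  have ha0 : 0 < a := Real.exp_pos _
  have hab : a < b := Real.exp_lt_exp.2 (by nlinarith)
  set φ : ℝ → ℝ := fun y => ramp a b y / max y a with hφd
  have hφ : Continuous φ :=
    (ramp_cont a b).div (by fun_prop) fun y => (ha0.trans_le (le_max_right _ _)).ne'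
  have hmul : ∀ y, y * φ y = ramp a b y := ramp_mul ha0 hab
  have hint := J_int hφ
  have hup : ∀ u, r ^ 2 < u → ramp a b (Real.exp (-u)) = 0 := fun u hu =>
    ramp_zero hab (Real.exp_le_exp.2 (by linarith))
  have hlo : ∀ u, u ≤ 1 → ramp a b (Real.exp (-u)) = 1 := fun u hu =>
    ramp_one hab (Real.exp_le_exp.2 (by linarith))
  refine ⟨T μ φ, J φ, T_cont hμ hsum htrace hC hφ, ?_, ?_, ?_⟩
  · obtain ⟨i1, i2⟩ := ind_int 1 zero_le_one
    rw [← i2]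
    refine integral_mono i1 hint fun v => ?_
    simp only [hmul]
    by_cases hv : v ∈ Ioc (0:ℝ) 1
    · rw [indicator_of_mem hv]
      exact (hlo _ (by nlinarith [hv.1, hv.2])).ge
    · rw [indicator_of_notMem hv]
      exact ramp_nonneg _ _ _
  · obtain ⟨i1, i2⟩ := ind_int r (by linarith)
    rw [← i2]
    refine setIntegral_mono_on hint i1 measurableSet_Ioi fun v hv => ?_
    simp only [hmul]
    by_cases h : v ≤ r
    · rw [indicator_of_mem (show v ∈ Ioc 0 r from ⟨hv, h⟩)]
      exact ramp_le_one _ _ _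
    · rw [indicator_of_notMem (fun h' => h h'.2), hup]
      push Not at h
      nlinarith
  · intro t ht
    have hs := T_sum hμ ht (hsum t ht) hφ
    simp only [T, hmul] at hs ⊢
    have hle : ∀ n x, μ n ≤ x / t ↔ μ n * t ≤ x := fun n x => le_div_iff₀ ht
    constructor
    · refine mul_le_mul_of_nonneg_left ?_ (Real.sqrt_nonneg t)
      have : (Nat.card {n : ℕ | μ n ≤ 1 / t} : ℝ)
          = ∑ n ∈ (hfin (1 / t)).toFinset, ramp a b (Real.exp (-(μ n * t))) := by
        rw [Finset.sum_congr rfl (g := fun _ => (1:ℝ))]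
        · rw [Nat.card_coe_set_eq, ncard_eq_toFinset_card _ (hfin (1 / t))]; simp
        · intro n hn
          exact hlo _ ((hle _ _).1 (by simpa using hn))
      rw [this]
      exact hs.sum_le_tsum _ fun n _ => ramp_nonneg _ _ _
    · refine mul_le_mul_of_nonneg_left ?_ (Real.sqrt_nonneg t)
      rw [tsum_eq_sum (s := (hfin (r ^ 2 / t)).toFinset)]
      · refine (Finset.sum_le_sum fun n _ => ramp_le_one _ _ _).trans ?_
        rw [Nat.card_coe_set_eq, ncard_eq_toFinset_card _ (hfin (r ^ 2 / t))]; simp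
      · intro n hn
        refine hup _ ?_
        have : ¬ μ n ≤ r ^ 2 / t := by simpa using hn
        rw [hle] at this
        exact not_le.1 this

lemma inv_tendsto {c : ℝ} (hc : 0 < c) : Tendsto (fun x : ℝ => c / x) atTop (𝓝[>] 0) := by
  refine tendsto_nhdsWithin_iff.2 ⟨tendsto_const_nhds.div_atTop tendsto_id, ?_⟩
  filter_upwards [eventually_gt_atTop 0] with x hx
  exact div_pos hc hx

lemma counting_limit (hμ : ∀ n, 0 ≤ μ n) (hfin : ∀ x : ℝ, {n : ℕ | μ n ≤ x}.Finite)
    (hsum : ∀ t : ℝ, 0 < t → Summable fun n : ℕ => Real.exp (-(μ n * t)))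
    (htrace : Tendsto (fun t : ℝ => Real.sqrt t * ∑' n : ℕ, Real.exp (-(μ n * t)))
      (𝓝[>] 0) (𝓝 C)) (hC : 0 ≤ C) :
    Tendsto (fun x : ℝ => (Nat.card {n : ℕ | μ n ≤ x} : ℝ) / Real.sqrt x)
        atTop (𝓝 (2 * C / Real.sqrt Real.pi)) := by
  set D := 2 * C / Real.sqrt Real.pi with hD
  have hD0 : 0 ≤ D := by positivity
  refine tendsto_order.2 ⟨fun A hA => ?_, fun A hA => ?_⟩
  · have hc : Tendsto (fun r : ℝ => r * A) (𝓝[>] 1) (𝓝 (1 * A)) :=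
      ((continuous_id.mul continuous_const).tendsto 1).mono_left nhdsWithin_le_nhds
    rw [one_mul] at hc
    obtain ⟨r, hrA, hr⟩ := ((hc.eventually (gt_mem_nhds hA)).and self_mem_nhdsWithin).exists
    have hr : 1 < r := hr
    obtain ⟨F, G, hF, hG1, hG2, hFt⟩ := sandwich hμ hfin hsum htrace hC hr
    have hDG : r * A < D * G := by nlinarith
    have hr2 : 0 < r ^ 2 := by positivity
    filter_upwards [(hF.comp (inv_tendsto hr2)).eventually (lt_mem_nhds hDG),
      eventually_gt_atTop 0] with x hx hx0
    have h := hx.trans_le (hFt (r ^ 2 / x) (by positivity)).2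
    rw [div_div_cancel₀ hr2.ne', Real.sqrt_div hr2.le, Real.sqrt_sq (by linarith),
      div_mul_eq_mul_div, mul_div_assoc] at h
    exact lt_of_mul_lt_mul_left h (by linarith)
  · have hc : Tendsto (fun r : ℝ => D * r) (𝓝[>] 1) (𝓝 (D * 1)) :=
      ((continuous_const.mul continuous_id).tendsto 1).mono_left nhdsWithin_le_nhds
    rw [mul_one] at hc
    obtain ⟨r, hrA, hr⟩ := ((hc.eventually (gt_mem_nhds hA)).and self_mem_nhdsWithin).exists
    have hr : 1 < r := hr
    obtain ⟨F, G, hF, hG1, hG2, hFt⟩ := sandwich hμ hfin hsum htrace hC hr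
    have hDG : D * G < A := by nlinarith
    filter_upwards [(hF.comp (inv_tendsto one_pos)).eventually (gt_mem_nhds hDG),
      eventually_gt_atTop 0] with x hx hx0
    have h := (hFt (1 / x) (by positivity)).1.trans_lt hx
    rwa [div_div_cancel₀ one_ne_zero, Real.sqrt_div zero_le_one, Real.sqrt_one,
      div_mul_eq_mul_div, one_mul] at h

end

end KaramataAux

/-- Karamata Tauberian theorem of order 1/2: if the heat trace `Σ_n e^{-μ_n t}`
converges for all `t > 0` and `√t · Σ_n e^{-μ_n t} → C` as `t → 0⁺`, then the
counting function `N(x) = #{n : μ_n ≤ x}` satisfies `N(x)/√x → 2C/√π`.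
In particular, if `C = 𝓛/√(4π)` then `N(k²)/k → 𝓛/π` as `k → ∞`. -/
theorem karamata_tauberian_order_one_half
    (μ : ℕ → ℝ) (hμ : ∀ n, 0 ≤ μ n)
    (hfin : ∀ x : ℝ, {n : ℕ | μ n ≤ x}.Finite)
    (C : ℝ) (hC : 0 ≤ C)
    (hsum : ∀ t : ℝ, 0 < t → Summable fun n : ℕ => Real.exp (-(μ n) * t))
    (htrace : Tendsto (fun t : ℝ => Real.sqrt t * ∑' n : ℕ, Real.exp (-(μ n) * t))
      (𝓝[>] 0) (𝓝 C)) :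
    Tendsto (fun x : ℝ => (Nat.card {n : ℕ | μ n ≤ x} : ℝ) / Real.sqrt x)
        atTop (𝓝 (2 * C / Real.sqrt Real.pi)) ∧
      ∀ L : ℝ, C = L / Real.sqrt (4 * Real.pi) →
        Tendsto (fun K : ℝ => (Nat.card {n : ℕ | μ n ≤ K ^ 2} : ℝ) / K)
          atTop (𝓝 (L / Real.pi)) := by
  have h1 : Tendsto (fun x : ℝ => (Nat.card {n : ℕ | μ n ≤ x} : ℝ) / Real.sqrt x)
        atTop (𝓝 (2 * C / Real.sqrt Real.pi)) := by
    simp only [neg_mul] at hsum htrace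
    exact KaramataAux.counting_limit hμ hfin hsum htrace hC
  refine ⟨h1, fun L hL => ?_⟩
  have h2 := h1.comp (tendsto_pow_atTop (α := ℝ) two_ne_zero)
  have hπ : Real.sqrt Real.pi ≠ 0 := (Real.sqrt_pos.2 Real.pi_pos).ne'
  have hL' : 2 * C / Real.sqrt Real.pi = L / Real.pi := by
    have h4 : Real.sqrt (4 * Real.pi) = 2 * Real.sqrt Real.pi := by
      rw [Real.sqrt_mul (by norm_num), show (4:ℝ) = 2 ^ 2 by norm_num,
        Real.sqrt_sq (by norm_num)]
    rw [hL, h4]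
    nth_rewrite 3 [← Real.mul_self_sqrt Real.pi_pos.le]
    field_simp
  rw [hL'] at h2
  refine h2.congr' ?_
  filter_upwards [eventually_ge_atTop 0] with K hK
  simp only [Function.comp, Real.sqrt_sq hK]
end

section
/- Let l > 0 and let f : ℝ → ℂ be continuously differentiable on [0,l]. Then for every δ with 0 < δ ≤ l one has |f(0)|² ≤ (2/δ) ∫₀^l |f(x)|² dx + δ ∫₀^l |f'(x)|² dx. -/
open Set

/-- One-dimensional trace estimate (Kuchment, Lemma 8): for `f` continuously
differentiable on `[0,l]` and `0 < δ ≤ l` one has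
`|f(0)|² ≤ (2/δ) ∫₀^l |f|² + δ ∫₀^l |f'|²`. -/
theorem boundary_value_estimate_interval
    (l : ℝ) (hl : 0 < l) (f f' : ℝ → ℂ)
    (hderiv : ∀ x ∈ Icc (0 : ℝ) l, HasDerivAt f (f' x) x)
    (hcont : ContinuousOn f' (Icc (0 : ℝ) l))
    (δ : ℝ) (hδ0 : 0 < δ) (hδl : δ ≤ l) :
    ‖f 0‖ ^ 2 ≤ (2 / δ) * (∫ x in (0 : ℝ)..l, ‖f x‖ ^ 2)
      + δ * (∫ x in (0 : ℝ)..l, ‖f' x‖ ^ 2) := by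
  have hsub : Icc (0:ℝ) δ ⊆ Icc 0 l := Icc_subset_Icc_right hδl
  have hf : ContinuousOn f (Icc 0 l) := fun x hx => (hderiv x hx).continuousAt.continuousWithinAt
  have hF2 : ContinuousOn (fun x => ‖f x‖ ^ 2) (Icc 0 l) := hf.norm.pow 2
  have hG2 : ContinuousOn (fun x => ‖f' x‖ ^ 2) (Icc 0 l) := hcont.norm.pow 2
  have hin : ContinuousOn (fun x => (inner ℝ (f x) (f' x) : ℝ)) (Icc 0 l) :=
    ContinuousOn.inner hf hcont
  have hg' : ContinuousOn (fun x => (-1) * ‖f x‖ ^ 2 + (δ - x) * (2 * (inner ℝ (f x) (f' x) : ℝ)))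
      (Icc 0 δ) :=
    ((continuousOn_const.mul hF2).add ((continuousOn_const.sub continuousOn_id).mul
      (continuousOn_const.mul hin))).mono hsub
  have hgi := hg'.intervalIntegrable_of_Icc (μ := MeasureTheory.volume) hδ0.le
  have hFi := (hF2.mono hsub).intervalIntegrable_of_Icc (μ := MeasureTheory.volume) hδ0.le
  have hGi := (hG2.mono hsub).intervalIntegrable_of_Icc (μ := MeasureTheory.volume) hδ0.le
  have hftc : ∫ x in (0:ℝ)..δ, ((-1) * ‖f x‖ ^ 2 + (δ - x) * (2 * (inner ℝ (f x) (f' x) : ℝ)))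
      = (δ - δ) * ‖f δ‖ ^ 2 - (δ - 0) * ‖f 0‖ ^ 2 := by
    refine intervalIntegral.integral_eq_sub_of_hasDerivAt
      (f := fun x => (δ - x) * ‖f x‖ ^ 2) (fun x hx => ?_) hgi
    rw [uIcc_of_le hδ0.le] at hx
    exact ((hasDerivAt_id x).const_sub δ).mul (hderiv x (hsub hx)).norm_sq
  have hmono : ∫ x in (0:ℝ)..δ, -((-1) * ‖f x‖ ^ 2 + (δ - x) * (2 * (inner ℝ (f x) (f' x) : ℝ)))
      ≤ ∫ x in (0:ℝ)..δ, (2 * ‖f x‖ ^ 2 + δ ^ 2 * ‖f' x‖ ^ 2) := by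
    refine intervalIntegral.integral_mono_on hδ0.le hgi.neg
      ((hFi.const_mul 2).add (hGi.const_mul (δ ^ 2))) (fun x hx => ?_)
    have h1 := abs_real_inner_le_norm (f x) (f' x)
    have h2 := (abs_le.1 h1).1
    have h3 : 0 ≤ δ - x := by linarith [hx.2]
    have h4 := mul_le_mul_of_nonneg_left h2 h3
    have h5 : (δ - x) ^ 2 * ‖f' x‖ ^ 2 ≤ δ ^ 2 * ‖f' x‖ ^ 2 := by
      gcongr
      linarith [hx.1]
    nlinarith [sq_nonneg (‖f x‖ - (δ - x) * ‖f' x‖)]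
  rw [intervalIntegral.integral_neg, hftc, intervalIntegral.integral_add (hFi.const_mul 2)
    (hGi.const_mul (δ ^ 2)), intervalIntegral.integral_const_mul,
    intervalIntegral.integral_const_mul] at hmono
  have hext : ∀ h : ℝ → ℂ, ContinuousOn (fun x => ‖h x‖ ^ 2) (Icc 0 l) →
      ∫ x in (0:ℝ)..δ, ‖h x‖ ^ 2 ≤ ∫ x in (0:ℝ)..l, ‖h x‖ ^ 2 := fun h hh =>
    intervalIntegral.integral_mono_interval le_rfl hδ0.le hδl
      (Filter.Eventually.of_forall fun x => sq_nonneg _) (hh.intervalIntegrable_of_Icc hl.le)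
  have e1 := hext f hF2
  have e2 := mul_le_mul_of_nonneg_left (hext f' hG2) (sq_nonneg δ)
  have key : δ * ‖f 0‖ ^ 2 ≤ δ * ((2 / δ) * (∫ x in (0 : ℝ)..l, ‖f x‖ ^ 2)
      + δ * (∫ x in (0 : ℝ)..l, ‖f' x‖ ^ 2)) := by
    have : δ * ((2 / δ) * (∫ x in (0 : ℝ)..l, ‖f x‖ ^ 2)
      + δ * (∫ x in (0 : ℝ)..l, ‖f' x‖ ^ 2)) = 2 * (∫ x in (0 : ℝ)..l, ‖f x‖ ^ 2)
      + δ ^ 2 * (∫ x in (0 : ℝ)..l, ‖f' x‖ ^ 2) := by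
      field_simp
    rw [this]
    linarith
  exact le_of_mul_le_mul_left key hδ0
end

section
/- For every ψ : ℝ² → ℂ continuously differentiable on D and every δ with 0 < δ ≤ l, the quadratic form satisfies Q_L[ψ] ≥ (1 − 4δ L_max) ‖∇ψ‖² − (8 L_max/δ) ‖ψ‖². In particular there is a constant C ≥ 0, depending only on l and L_max, such that Q_L[ψ] ≥ −C ‖ψ‖² for all such ψ. -/
open Set MeasureTheory

/-- `ψ` is continuously differentiable on the rectangle `[0,a] × [0,b]`, with
partial derivatives `ψx` and `ψy`. -/
def IsC1OnRect (a b : ℝ) (ψ ψx ψy : ℝ × ℝ → ℂ) : Prop :=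
  (∀ p ∈ Set.Icc ((0 : ℝ), (0 : ℝ)) (a, b),
    HasFDerivAt ψ
      ((ContinuousLinearMap.fst ℝ ℝ ℝ).smulRight (ψx p)
        + (ContinuousLinearMap.snd ℝ ℝ ℝ).smulRight (ψy p)) p) ∧
    ContinuousOn ψx (Set.Icc ((0 : ℝ), (0 : ℝ)) (a, b)) ∧
    ContinuousOn ψy (Set.Icc ((0 : ℝ), (0 : ℝ)) (a, b))

/-- The boundary-value vector `ψ_bv(y) = (ψ(0,y), ψ(l,y), ψ(y,0), ψ(y,l)) ∈ ℂ⁴`. -/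
noncomputable def bv (l : ℝ) (ψ : ℝ × ℝ → ℂ) (y : ℝ) : Fin 4 → ℂ :=
  ![ψ (0, y), ψ (l, y), ψ (y, 0), ψ (y, l)]

/-- The squared `L²` norm `‖∇ψ‖² = ∫_D (|∂ₓψ|² + |∂_yψ|²)` on `D = [0,l]²`. -/
noncomputable def gradNormSq (l : ℝ) (ψx ψy : ℝ × ℝ → ℂ) : ℝ :=
  ∫ x in (0 : ℝ)..l, ∫ y in (0 : ℝ)..l, (‖ψx (x, y)‖ ^ 2 + ‖ψy (x, y)‖ ^ 2)

/-- The squared `L²` norm `‖ψ‖² = ∫_D |ψ|²` on `D = [0,l]²`. -/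
noncomputable def normSq (l : ℝ) (ψ : ℝ × ℝ → ℂ) : ℝ :=
  ∫ x in (0 : ℝ)..l, ∫ y in (0 : ℝ)..l, ‖ψ (x, y)‖ ^ 2

/-- The two-particle quadratic form
`Q_L[ψ] = ‖∇ψ‖² − ∫₀^l ⟨ψ_bv(y), L(y) ψ_bv(y)⟩_{ℂ⁴} dy`. -/
noncomputable def quadForm (l : ℝ) (L : ℝ → Matrix (Fin 4) (Fin 4) ℂ)
    (ψ ψx ψy : ℝ × ℝ → ℂ) : ℝ :=
  gradNormSq l ψx ψy -
    (∫ y in (0 : ℝ)..l,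
      ∑ i, (starRingEnd ℂ) (bv l ψ y i) * (L y).mulVec (bv l ψ y) i).re

lemma trace_left {l δ : ℝ} (hδ : 0 < δ) (hδl : δ ≤ l) {f f' : ℝ → ℂ}
    (hf : ∀ t ∈ Icc 0 l, HasDerivAt f (f' t) t) (hf' : ContinuousOn f' (Icc 0 l)) :
    ‖f 0‖ ^ 2 ≤ (2 / δ) * (∫ t in (0:ℝ)..l, ‖f t‖ ^ 2) + δ * ∫ t in (0:ℝ)..l, ‖f' t‖ ^ 2 := by
  have hfc : ContinuousOn f (Icc 0 l) := fun t ht => (hf t ht).continuousAt.continuousWithinAt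
  have hl : 0 ≤ l := hδ.le.trans hδl
  have hsub : Icc 0 δ ⊆ Icc 0 l := Icc_subset_Icc_right hδl
  have h1c : ContinuousOn (fun t => ‖f t‖ ^ 2) (Icc 0 l) := by fun_prop
  have h2c : ContinuousOn (fun t => ‖f' t‖ ^ 2) (Icc 0 l) := by fun_prop
  have h3c : ContinuousOn (fun t => (-1) * ‖f t‖ ^ 2 + (δ - t) * (2 * inner ℝ (f t) (f' t))) (Icc 0 l) := by
    fun_prop
  have hftc := intervalIntegral.integral_eq_sub_of_hasDerivAt (a := 0) (b := δ)
    (f := fun t => (δ - t) * ‖f t‖ ^ 2)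
    (f' := fun t => (-1) * ‖f t‖ ^ 2 + (δ - t) * (2 * inner ℝ (f t) (f' t)))
    (by
      intro t ht
      rw [uIcc_of_le hδ.le] at ht
      exact ((hasDerivAt_id t).const_sub δ).mul (hf t (hsub ht)).norm_sq)
    ((h3c.mono hsub).intervalIntegrable_of_Icc hδ.le)
  simp only [sub_self, zero_mul, sub_zero, zero_sub] at hftc
  have i1 : IntervalIntegrable (fun t => ‖f t‖ ^ 2) volume 0 δ :=
    (h1c.mono hsub).intervalIntegrable_of_Icc hδ.le
  have i2 : IntervalIntegrable (fun t => ‖f' t‖ ^ 2) volume 0 δ :=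
    (h2c.mono hsub).intervalIntegrable_of_Icc hδ.le
  have hmono := intervalIntegral.integral_mono_on (a := 0) (b := δ) hδ.le
    (f := fun t => -((-1) * ‖f t‖ ^ 2 + (δ - t) * (2 * inner ℝ (f t) (f' t))))
    (g := fun t => 2 * ‖f t‖ ^ 2 + δ ^ 2 * ‖f' t‖ ^ 2)
    ((h3c.mono hsub).intervalIntegrable_of_Icc hδ.le).neg
    ((i1.const_mul 2).add (i2.const_mul _))
    (by
      intro t ht
      have hin := abs_real_inner_le_norm (f t) (f' t)
      have h0 : 0 ≤ δ - t := by linarith [ht.2]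
      have h1 : -inner ℝ (f t) (f' t) ≤ ‖f t‖ * ‖f' t‖ := (neg_le_abs _).trans hin
      have h2 := mul_le_mul_of_nonneg_left h1 h0
      have h3 : (δ - t) ^ 2 ≤ δ ^ 2 := by
        apply pow_le_pow_left₀ h0; linarith [ht.1]
      have h4 := mul_le_mul_of_nonneg_right h3 (sq_nonneg ‖f' t‖)
      nlinarith [sq_nonneg (‖f t‖ - (δ - t) * ‖f' t‖)])
  rw [intervalIntegral.integral_neg, hftc, intervalIntegral.integral_add (i1.const_mul 2) (i2.const_mul _),
    intervalIntegral.integral_const_mul, intervalIntegral.integral_const_mul, neg_neg] at hmono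
  have e1 : ∫ t in (0:ℝ)..δ, ‖f t‖ ^ 2 ≤ ∫ t in (0:ℝ)..l, ‖f t‖ ^ 2 :=
    intervalIntegral.integral_mono_interval le_rfl hδ.le hδl
      (Filter.Eventually.of_forall fun t => by positivity) (h1c.intervalIntegrable_of_Icc hl)
  have e2 : ∫ t in (0:ℝ)..δ, ‖f' t‖ ^ 2 ≤ ∫ t in (0:ℝ)..l, ‖f' t‖ ^ 2 :=
    intervalIntegral.integral_mono_interval le_rfl hδ.le hδl
      (Filter.Eventually.of_forall fun t => by positivity) (h2c.intervalIntegrable_of_Icc hl)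
  have e3 := mul_le_mul_of_nonneg_left e2 (sq_nonneg δ)
  have : δ * ‖f 0‖ ^ 2 ≤ δ * ((2 / δ) * (∫ t in (0:ℝ)..l, ‖f t‖ ^ 2) + δ * ∫ t in (0:ℝ)..l, ‖f' t‖ ^ 2) := by
    rw [mul_add, ← mul_assoc, mul_div_cancel₀ _ hδ.ne']
    linarith
  exact le_of_mul_le_mul_left this hδ

lemma trace_right {l δ : ℝ} (hδ : 0 < δ) (hδl : δ ≤ l) {f f' : ℝ → ℂ}
    (hf : ∀ t ∈ Icc 0 l, HasDerivAt f (f' t) t) (hf' : ContinuousOn f' (Icc 0 l)) :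
    ‖f l‖ ^ 2 ≤ (2 / δ) * (∫ t in (0:ℝ)..l, ‖f t‖ ^ 2) + δ * ∫ t in (0:ℝ)..l, ‖f' t‖ ^ 2 := by
  have hm : ∀ t ∈ Icc 0 l, l - t ∈ Icc 0 l := fun t ht => ⟨by linarith [ht.2], by linarith [ht.1]⟩
  have h := trace_left hδ hδl (f := fun t => f (l - t)) (f' := fun t => -f' (l - t))
    (fun t ht => by
      exact (hf (l - t) (hm t ht)).comp_const_sub l t)
    ((hf'.comp (by fun_prop) hm).neg)
  simp only [norm_neg, sub_zero] at h
  rwa [intervalIntegral.integral_comp_sub_left (fun t => ‖f t‖ ^ 2),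
    intervalIntegral.integral_comp_sub_left (fun t => ‖f' t‖ ^ 2), sub_self, sub_zero] at h

lemma form_bound (M : Matrix (Fin 4) (Fin 4) ℂ) (v : Fin 4 → ℂ) (K : ℝ)
    (h : ‖(EuclideanSpace.equiv (Fin 4) ℂ).symm (M.mulVec v)‖
        ≤ K * ‖(EuclideanSpace.equiv (Fin 4) ℂ).symm v‖) :
    ‖∑ i, (starRingEnd ℂ) (v i) * M.mulVec v i‖ ≤ K * ∑ i, ‖v i‖ ^ 2 := by
  have h1 := norm_inner_le_norm (𝕜 := ℂ) ((EuclideanSpace.equiv (Fin 4) ℂ).symm v)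
    ((EuclideanSpace.equiv (Fin 4) ℂ).symm (M.mulVec v))
  have h2 : ‖(EuclideanSpace.equiv (Fin 4) ℂ).symm v‖ ^ 2 = ∑ i, ‖v i‖ ^ 2 := by
    rw [EuclideanSpace.norm_sq_eq]; rfl
  have h3 : inner ℂ ((EuclideanSpace.equiv (Fin 4) ℂ).symm v)
    ((EuclideanSpace.equiv (Fin 4) ℂ).symm (M.mulVec v)) = ∑ i, (starRingEnd ℂ) (v i) * M.mulVec v i := by
    rw [PiLp.inner_apply]
    refine Finset.sum_congr rfl fun i _ => ?_
    rw [RCLike.inner_apply]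
    exact mul_comm _ _
  rw [h3] at h1
  rw [← h2]
  refine h1.trans ((mul_le_mul_of_nonneg_left h (norm_nonneg _)).trans (le_of_eq (by ring)))

lemma swap_sq {l : ℝ} (hl : 0 ≤ l) {A : ℝ × ℝ → ℝ} (hA : Continuous A) :
    ∫ y in (0:ℝ)..l, ∫ x in (0:ℝ)..l, A (x, y) = ∫ x in (0:ℝ)..l, ∫ y in (0:ℝ)..l, A (x, y) := by
  simp only [intervalIntegral.integral_of_le hl]
  refine integral_integral_swap (f := fun y x => A (x, y)) ?_
  rw [Measure.prod_restrict]
  have hc : Continuous (Function.uncurry fun y x => A (x, y)) :=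
    hA.comp (continuous_snd.prodMk continuous_fst)
  exact (hc.continuousOn.integrableOn_compact (isCompact_Icc.prod isCompact_Icc)).mono_set
    (prod_mono Ioc_subset_Icc_self Ioc_subset_Icc_self)

lemma extend_sq {l : ℝ} (hl : 0 ≤ l) {f : ℝ × ℝ → ℂ}
    (hf : ContinuousOn f (Icc ((0:ℝ), (0:ℝ)) (l, l))) :
    ∃ A : ℝ × ℝ → ℝ, Continuous A ∧ ∀ x ∈ Icc 0 l, ∀ y ∈ Icc 0 l, A (x, y) = ‖f (x, y)‖ ^ 2 := by
  refine ⟨fun p => ‖f (max 0 (min p.1 l), max 0 (min p.2 l))‖ ^ 2, ?_, ?_⟩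
  · have : Continuous fun p : ℝ × ℝ => f (max 0 (min p.1 l), max 0 (min p.2 l)) := by
      refine hf.comp_continuous (by fun_prop) fun p => ?_
      refine ⟨⟨le_max_left _ _, le_max_left _ _⟩, ⟨?_, ?_⟩⟩
      · exact max_le hl (min_le_right _ _)
      · exact max_le hl (min_le_right _ _)
    exact this.norm.pow 2
  · intro x hx y hy
    simp [min_eq_left hx.2, min_eq_left hy.2, max_eq_right hx.1, max_eq_right hy.1]

lemma integral_congr_Icc {l : ℝ} (hl : 0 ≤ l) {f g : ℝ → ℝ} (h : ∀ t ∈ Icc 0 l, f t = g t) :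
    ∫ t in (0:ℝ)..l, f t = ∫ t in (0:ℝ)..l, g t :=
  intervalIntegral.integral_congr fun t ht => h t (by rwa [uIcc_of_le hl] at ht)

lemma slice_cont {l : ℝ} {A : ℝ × ℝ → ℝ} (hA : Continuous A) :
    Continuous fun x => ∫ y in (0:ℝ)..l, A (x, y) :=
  intervalIntegral.continuous_parametric_intervalIntegral_of_continuous' (by fun_prop) 0 l

lemma main_bound
    (l : ℝ) (hl : 0 < l) (Lmax : ℝ) (hLmax : 0 ≤ Lmax)
    (L : ℝ → Matrix (Fin 4) (Fin 4) ℂ)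
    (hbound : ∀ᵐ y ∂(volume.restrict (Icc (0 : ℝ) l)), ∀ v : Fin 4 → ℂ,
      ‖(EuclideanSpace.equiv (Fin 4) ℂ).symm ((L y).mulVec v)‖
        ≤ Lmax * ‖(EuclideanSpace.equiv (Fin 4) ℂ).symm v‖)
    (ψ ψx ψy : ℝ × ℝ → ℂ) (h : IsC1OnRect l l ψ ψx ψy) (δ : ℝ) (hδ : 0 < δ) (hδl : δ ≤ l) :
    quadForm l L ψ ψx ψy ≥
        (1 - 4 * δ * Lmax) * gradNormSq l ψx ψy - (8 * Lmax / δ) * normSq l ψ := by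
  obtain ⟨hd, hcx, hcy⟩ := h
  have hl0 := hl.le
  have hψc : ContinuousOn ψ (Icc ((0:ℝ), (0:ℝ)) (l, l)) :=
    fun p hp => (hd p hp).continuousAt.continuousWithinAt
  obtain ⟨A, hA, hAe⟩ := extend_sq hl0 hψc
  obtain ⟨B, hB, hBe⟩ := extend_sq hl0 hcx
  obtain ⟨C, hC, hCe⟩ := extend_sq hl0 hcy
  have hmem : ∀ x ∈ Icc 0 l, ∀ y ∈ Icc 0 l, (x, y) ∈ Icc ((0:ℝ), (0:ℝ)) (l, l) :=
    fun x hx y hy => ⟨⟨hx.1, hy.1⟩, ⟨hx.2, hy.2⟩⟩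
  have hN : normSq l ψ = ∫ x in (0:ℝ)..l, ∫ y in (0:ℝ)..l, A (x, y) :=
    integral_congr_Icc hl0 fun x hx => integral_congr_Icc hl0 fun y hy => (hAe x hx y hy).symm
  have hG : gradNormSq l ψx ψy = (∫ x in (0:ℝ)..l, ∫ y in (0:ℝ)..l, B (x, y)) +
      ∫ x in (0:ℝ)..l, ∫ y in (0:ℝ)..l, C (x, y) := by
    rw [← intervalIntegral.integral_add ((slice_cont hB).intervalIntegrable _ _)
      ((slice_cont hC).intervalIntegrable _ _)]
    refine integral_congr_Icc hl0 fun x hx => ?_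
    rw [← intervalIntegral.integral_add
      (Continuous.intervalIntegrable (by fun_prop) _ _)
      (Continuous.intervalIntegrable (by fun_prop) _ _)]
    refine integral_congr_Icc hl0 fun y hy => ?_
    rw [hBe x hx y hy, hCe x hx y hy]
  have hB0 : 0 ≤ ∫ x in (0:ℝ)..l, ∫ y in (0:ℝ)..l, B (x, y) :=
    intervalIntegral.integral_nonneg hl0 fun x hx =>
      intervalIntegral.integral_nonneg hl0 fun y hy => by rw [hBe x hx y hy]; positivity
  have hC0 : 0 ≤ ∫ x in (0:ℝ)..l, ∫ y in (0:ℝ)..l, C (x, y) :=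
    intervalIntegral.integral_nonneg hl0 fun x hx =>
      intervalIntegral.integral_nonneg hl0 fun y hy => by rw [hCe x hx y hy]; positivity
  -- slices of the derivative
  have hdx : ∀ y ∈ Icc 0 l, ∀ x ∈ Icc 0 l,
      HasDerivAt (fun t => ψ (t, y)) (ψx (x, y)) x := by
    intro y hy x hx
    have := (hd (x, y) (hmem x hx y hy)).comp_hasDerivAt x
      ((hasDerivAt_id x).prodMk (hasDerivAt_const x y))
    simpa [Function.comp_def] using this
  have hdy : ∀ x ∈ Icc 0 l, ∀ y ∈ Icc 0 l,
      HasDerivAt (fun t => ψ (x, t)) (ψy (x, y)) y := by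
    intro x hx y hy
    have := (hd (x, y) (hmem x hx y hy)).comp_hasDerivAt y
      ((hasDerivAt_const y x).prodMk (hasDerivAt_id y))
    simpa [Function.comp_def] using this
  have hsx : ∀ y ∈ Icc 0 l, ContinuousOn (fun t => ψx (t, y)) (Icc 0 l) :=
    fun y hy => hcx.comp (by fun_prop) fun x hx => hmem x hx y hy
  have hsy : ∀ x ∈ Icc 0 l, ContinuousOn (fun t => ψy (x, t)) (Icc 0 l) :=
    fun x hx => hcy.comp (by fun_prop) fun y hy => hmem x hx y hy
  let A1 : ℝ → ℝ := fun y => ∫ x in (0:ℝ)..l, A (x, y)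
  let A2 : ℝ → ℝ := fun y => ∫ x in (0:ℝ)..l, A (y, x)
  let B1 : ℝ → ℝ := fun y => ∫ x in (0:ℝ)..l, B (x, y)
  let C2 : ℝ → ℝ := fun y => ∫ x in (0:ℝ)..l, C (y, x)
  have cA1 : Continuous A1 := slice_cont (A := fun p => A (p.2, p.1)) (by fun_prop)
  have cA2 : Continuous A2 := slice_cont hA
  have cB1 : Continuous B1 := slice_cont (A := fun p => B (p.2, p.1)) (by fun_prop)
  have cC2 : Continuous C2 := slice_cont hC
  have hbv : ∀ y ∈ Icc 0 l, ∑ i, ‖bv l ψ y i‖ ^ 2 ≤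
      (4 / δ) * (A1 y + A2 y) + 2 * δ * (B1 y + C2 y) := by
    intro y hy
    have t1 := trace_left hδ hδl (hdx y hy) (hsx y hy)
    have t2 := trace_right hδ hδl (hdx y hy) (hsx y hy)
    have t3 := trace_left hδ hδl (hdy y hy) (hsy y hy)
    have t4 := trace_right hδ hδl (hdy y hy) (hsy y hy)
    have eA1 : ∫ t in (0:ℝ)..l, ‖ψ (t, y)‖ ^ 2 = A1 y :=
      integral_congr_Icc hl0 fun x hx => (hAe x hx y hy).symm
    have eA2 : ∫ t in (0:ℝ)..l, ‖ψ (y, t)‖ ^ 2 = A2 y :=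
      integral_congr_Icc hl0 fun x hx => (hAe y hy x hx).symm
    have eB1 : ∫ t in (0:ℝ)..l, ‖ψx (t, y)‖ ^ 2 = B1 y :=
      integral_congr_Icc hl0 fun x hx => (hBe x hx y hy).symm
    have eC2 : ∫ t in (0:ℝ)..l, ‖ψy (y, t)‖ ^ 2 = C2 y :=
      integral_congr_Icc hl0 fun x hx => (hCe y hy x hx).symm
    simp only [eA1, eA2, eB1, eC2] at t1 t2 t3 t4
    have e4 : 4 / δ = 2 * (2 / δ) := by ring
    have es : ∑ i, ‖bv l ψ y i‖ ^ 2 = ‖ψ (0, y)‖ ^ 2 + ‖ψ (l, y)‖ ^ 2 + ‖ψ (y, 0)‖ ^ 2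
        + ‖ψ (y, l)‖ ^ 2 := by
      rw [Fin.sum_univ_four]; rfl
    rw [e4, es]
    linarith
  have key := intervalIntegral.norm_integral_le_of_norm_le (μ := volume) (a := 0) (b := l) hl0
    (f := fun y => ∑ i, (starRingEnd ℂ) (bv l ψ y i) * (L y).mulVec (bv l ψ y) i)
    (g := fun y => Lmax * ((4 / δ) * (A1 y + A2 y) + 2 * δ * (B1 y + C2 y)))
    (by
      filter_upwards [(ae_restrict_iff' measurableSet_Icc).1 hbound] with y hy hyI
      have hyI' := Ioc_subset_Icc_self hyI
      exact (form_bound _ _ _ (hy hyI' _)).trans (mul_le_mul_of_nonneg_left (hbv y hyI') hLmax))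
    (Continuous.intervalIntegrable (by fun_prop) _ _)
  rw [intervalIntegral.integral_const_mul,
    intervalIntegral.integral_add (Continuous.intervalIntegrable (by fun_prop) _ _)
      (Continuous.intervalIntegrable (by fun_prop) _ _),
    intervalIntegral.integral_const_mul, intervalIntegral.integral_const_mul,
    intervalIntegral.integral_add (cA1.intervalIntegrable _ _) (cA2.intervalIntegrable _ _),
    intervalIntegral.integral_add (cB1.intervalIntegrable _ _) (cC2.intervalIntegrable _ _)] at key
  have sA : ∫ y in (0:ℝ)..l, A1 y = ∫ x in (0:ℝ)..l, ∫ y in (0:ℝ)..l, A (x, y) := swap_sq hl0 hA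
  have sB : ∫ y in (0:ℝ)..l, B1 y = ∫ x in (0:ℝ)..l, ∫ y in (0:ℝ)..l, B (x, y) := swap_sq hl0 hB
  have sA2 : ∫ y in (0:ℝ)..l, A2 y = ∫ x in (0:ℝ)..l, ∫ y in (0:ℝ)..l, A (x, y) := rfl
  have sC : ∫ y in (0:ℝ)..l, C2 y = ∫ x in (0:ℝ)..l, ∫ y in (0:ℝ)..l, C (x, y) := rfl
  rw [sA, sB, sA2, sC, ← hN, ← hG] at key
  have hre := (Complex.re_le_norm _).trans key
  have hG0 : 0 ≤ gradNormSq l ψx ψy := by rw [hG]; exact add_nonneg hB0 hC0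
  have hpos : 0 ≤ Lmax * δ * gradNormSq l ψx ψy := by positivity
  have e : Lmax * (4 / δ * (normSq l ψ + normSq l ψ) + 2 * δ * gradNormSq l ψx ψy)
      = 8 * Lmax / δ * normSq l ψ + 2 * (Lmax * δ * gradNormSq l ψx ψy) := by ring
  rw [e] at hre
  unfold quadForm
  linarith

lemma gradNormSq_nonneg {l : ℝ} (hl : 0 ≤ l) (ψx ψy : ℝ × ℝ → ℂ) : 0 ≤ gradNormSq l ψx ψy :=
  intervalIntegral.integral_nonneg hl fun x _ =>
    intervalIntegral.integral_nonneg hl fun y _ => by positivity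

/-- Semi-boundedness of the two-particle quadratic form `Q_L`: for any `0 < δ ≤ l`,
`Q_L[ψ] ≥ (1 − 4δ L_max) ‖∇ψ‖² − (8 L_max/δ) ‖ψ‖²`, and in particular there is a
constant `C ≥ 0` with `Q_L[ψ] ≥ −C ‖ψ‖²` for all `ψ` continuously differentiable
on `D = [0,l]²`. -/
theorem quadForm_semibounded
    (l : ℝ) (hl : 0 < l) (Lmax : ℝ) (hLmax : 0 ≤ Lmax)
    (L : ℝ → Matrix (Fin 4) (Fin 4) ℂ)
    (hmeas : ∀ i j, Measurable fun y => L y i j)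
    (hherm : ∀ᵐ y ∂(volume.restrict (Icc (0 : ℝ) l)), (L y).IsHermitian)
    (hbound : ∀ᵐ y ∂(volume.restrict (Icc (0 : ℝ) l)), ∀ v : Fin 4 → ℂ,
      ‖(EuclideanSpace.equiv (Fin 4) ℂ).symm ((L y).mulVec v)‖
        ≤ Lmax * ‖(EuclideanSpace.equiv (Fin 4) ℂ).symm v‖) :
    (∀ ψ ψx ψy : ℝ × ℝ → ℂ, IsC1OnRect l l ψ ψx ψy → ∀ δ : ℝ, 0 < δ → δ ≤ l →
      quadForm l L ψ ψx ψy ≥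
        (1 - 4 * δ * Lmax) * gradNormSq l ψx ψy - (8 * Lmax / δ) * normSq l ψ) ∧
      ∃ C : ℝ, 0 ≤ C ∧ ∀ ψ ψx ψy : ℝ × ℝ → ℂ, IsC1OnRect l l ψ ψx ψy →
        quadForm l L ψ ψx ψy ≥ -C * normSq l ψ := by
  have hmain := main_bound l hl Lmax hLmax L hbound
  refine ⟨hmain, ?_⟩
  have hδ : 0 < min l (1 / (4 * (Lmax + 1))) := lt_min hl (by positivity)
  refine ⟨8 * Lmax / min l (1 / (4 * (Lmax + 1))), by positivity, fun ψ ψx ψy h => ?_⟩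
  have h1 := hmain ψ ψx ψy h _ hδ (min_le_left _ _)
  have h2 : 0 ≤ 1 - 4 * min l (1 / (4 * (Lmax + 1))) * Lmax := by
    have h3 := min_le_right l (1 / (4 * (Lmax + 1)))
    have h4 : min l (1 / (4 * (Lmax + 1))) * (4 * (Lmax + 1)) ≤ 1 :=
      (le_div_iff₀ (by positivity)).1 h3
    nlinarith
  have h5 := mul_nonneg h2 (gradNormSq_nonneg hl.le ψx ψy)
  linarith
end
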